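/- arXiv:2403.10661 — 2 statements merged into one kernel-verified Lean document; each statement's English description precedes it below -/
import Mathlib

section
/- Let C ⊆ A^n be a smooth algebraic curve having a polynomial parametric representation that satisfies conditions (P1) and (P2). Then deg(TC) = 2·deg(C) − 1. -/
open MvPolynomial

/-- A subset of affine space is an algebraic set if it is the zero locus of an
ideal of polynomials. -/
def IsAlgebraicSet {K : Type} [Field K] {n : ℕ} (W : Set (Fin n → K)) : Prop :=
  ∃ I : Ideal (MvPolynomial (Fin n) K), W = zeroLocus K I

/-- An irreducible affine variety: an algebraic set whose vanishing ideal is prime. -/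
def IsIrreducibleVariety {K : Type} [Field K] {n : ℕ} (W : Set (Fin n → K)) : Prop :=
  IsAlgebraicSet W ∧ (vanishingIdeal K W).IsPrime

/-- The dimension of an affine algebraic set: the Krull dimension of its coordinate ring. -/
noncomputable def varDim {K : Type} [Field K] {n : ℕ} (W : Set (Fin n → K)) : ℕ :=
  ENat.toNat ((ringKrullDim (MvPolynomial (Fin n) K ⧸ vanishingIdeal K W)).unbotD 0)

/-- The (Zariski) tangent space of `W` at `p`:
all `y` with `∇f(p)·y = 0` for every `f ∈ I(W)`. -/
def tangentSpaceAt {K : Type} [Field K] {n : ℕ} (W : Set (Fin n → K)) (p : Fin n → K) :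
    Set (Fin n → K) :=
  {y | ∀ f ∈ vanishingIdeal K W, ∑ i, eval p (pderiv i f) * y i = 0}

/-- The dimension of the tangent space at a point. -/
noncomputable def tangentDimAt {K : Type} [Field K] {n : ℕ} (W : Set (Fin n → K))
    (p : Fin n → K) : ℕ :=
  Module.finrank K (Submodule.span K (tangentSpaceAt W p))

/-- A point of an (irreducible) variety is a smooth point when the tangent space has
the dimension of the variety. -/
def IsSmoothAt {K : Type} [Field K] {n : ℕ} (W : Set (Fin n → K)) (p : Fin n → K) : Prop :=
  tangentDimAt W p = varDim W

/-- A variety is smooth if it is smooth at each of its points. -/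
def IsSmoothVariety {K : Type} [Field K] {n : ℕ} (W : Set (Fin n → K)) : Prop :=
  ∀ p ∈ W, IsSmoothAt W p

/-- Projection `A^{2n} → A^n` to the first `n` coordinates. -/
def fstProj {K : Type} {n : ℕ} (z : Fin (n + n) → K) : Fin n → K :=
  fun i => z (Fin.castAdd n i)

/-- Projection `A^{2n} → A^n` to the last `n` coordinates. -/
def sndProj {K : Type} {n : ℕ} (z : Fin (n + n) → K) : Fin n → K :=
  fun i => z (Fin.natAdd n i)

/-- The tangent bundle `TW ⊆ A^{2n}`: pairs `(x, y)` with `x ∈ W` and `y ∈ T_x W`. -/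
def tangentBundle {K : Type} [Field K] {n : ℕ} (W : Set (Fin n → K)) :
    Set (Fin (n + n) → K) :=
  {z | fstProj z ∈ W ∧ sndProj z ∈ tangentSpaceAt W (fstProj z)}

/-- Zariski closure of a subset of affine space. -/
def zclosure {K : Type} [Field K] {n : ℕ} (W : Set (Fin n → K)) : Set (Fin n → K) :=
  zeroLocus K (vanishingIdeal K W)

/-- The tangential variety `Tan(W)`: the Zariski closure of `π₂(TW)`. -/
def tangentialVariety {K : Type} [Field K] {n : ℕ} (W : Set (Fin n → K)) :
    Set (Fin n → K) :=
  zclosure (sndProj '' tangentBundle W)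

/-- The geometric degree of an (irreducible) affine algebraic set: the maximal finite
number of points in an intersection with an affine-linear subspace of complementary
dimension. -/
noncomputable def geomDegree {K : Type} [Field K] {n : ℕ} (W : Set (Fin n → K)) : ℕ :=
  sSup {m | ∃ L : AffineSubspace K (Fin n → K),
    Module.finrank K L.direction = n - varDim W ∧
    (W ∩ (L : Set (Fin n → K))).Finite ∧ (W ∩ (L : Set (Fin n → K))).ncard = m}

/-- A linear variety: an affine-linear subspace of affine space. -/
def IsLinearVariety {K : Type} [Field K] {n : ℕ} (W : Set (Fin n → K)) : Prop :=
  ∃ L : AffineSubspace K (Fin n → K), W = (L : Set (Fin n → K))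

/-- A line: an affine-linear subspace of dimension 1. -/
def IsLine {K : Type} [Field K] {n : ℕ} (W : Set (Fin n → K)) : Prop :=
  ∃ L : AffineSubspace K (Fin n → K), W = (L : Set (Fin n → K)) ∧
    Module.finrank K L.direction = 1

open Classical in
/-- `ω(C)`: the number of points in the fiber of `π₂ : TC → Tan(C)` over a generic
point of `Tan(C)`; it is `0` when `C` is a line. -/
noncomputable def omegaCurve {K : Type} [Field K] {n : ℕ} (C : Set (Fin n → K)) : ℕ :=
  if IsLine C then 0
  else sInf {m | ∃ Z : Set (Fin n → K), IsAlgebraicSet Z ∧ ¬ tangentialVariety C ⊆ Z ∧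
    ∀ v ∈ tangentialVariety C \ Z,
      {z ∈ tangentBundle C | sndProj z = v}.ncard = m}

/-- A smooth irreducible algebraic curve. -/
def IsSmoothCurve {K : Type} [Field K] {n : ℕ} (C : Set (Fin n → K)) : Prop :=
  IsIrreducibleVariety C ∧ varDim C = 1 ∧ IsSmoothVariety C

lemma ker_eq_aux {K : Type} [Field K] [Infinite K] {n : ℕ} (C : Set (Fin n → K))
    (g : Fin n → Polynomial K)
    (hdom : C = zclosure (Set.range fun t => fun i => (g i).eval t))
    (f : MvPolynomial (Fin n) K) : f ∈ vanishingIdeal K C ↔ aeval g f = 0 := by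
  have key : ∀ t : K, aeval (fun i => (g i).eval t) f = (aeval g f).eval t := by
    intro t
    induction f using MvPolynomial.induction_on with
    | C a => simp
    | add p q hp hq => simp only [map_add, hp, hq, Polynomial.eval_add]
    | mul_X p i hp => simp only [map_mul, hp, Polynomial.eval_mul, aeval_X]
  constructor
  · intro h
    apply Polynomial.funext
    intro t
    rw [← key, Polynomial.eval_zero]
    apply h
    rw [hdom]
    intro q hq
    exact hq _ ⟨t, rfl⟩
  · intro h x hx
    rw [hdom] at hx
    apply hx
    rintro _ ⟨t, rfl⟩
    simp only []
    rw [key, h, Polynomial.eval_zero]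

lemma taylor_aux {K : Type} [Field K] {n : ℕ} (p : Fin n → K) (f : MvPolynomial (Fin n) K)
    (h0 : eval p f = 0) (h1 : ∀ i, eval p (pderiv i f) = 0) :
    f ∈ (vanishingIdeal K {p}) ^ 2 := by
  have hX : ∀ i, (X i - C (p i) : MvPolynomial (Fin n) K) ∈ vanishingIdeal K {p} := by
    intro i
    rw [mem_vanishingIdeal_singleton_iff]
    simp
  have hs : ∀ f : MvPolynomial (Fin n) K,
      f - C (eval p f) ∈ Ideal.span (Set.range fun i => (X i - C (p i) : MvPolynomial (Fin n) K)) := by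
    intro f
    induction f using MvPolynomial.induction_on with
    | C a => simp
    | add u v hu hv =>
      have := Ideal.add_mem _ hu hv
      simp only [map_add]
      convert this using 1
      ring
    | mul_X u i hu =>
      have h1 := Ideal.mul_mem_right (X i) _ hu
      have h2 := Ideal.mul_mem_left _ (C (eval p u))
        (Ideal.subset_span (Set.mem_range_self (f := fun i => (X i - C (p i) : MvPolynomial (Fin n) K)) i))
      have := Ideal.add_mem _ h1 h2
      simp only [map_mul, eval_X]
      convert this using 1
      ring
  have hf := hs f
  rw [h0, map_zero, sub_zero, Ideal.mem_span_range_iff_exists_fun] at hf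
  obtain ⟨c, rfl⟩ := hf
  rw [pow_two]
  refine Ideal.sum_mem _ fun i _ => Ideal.mul_mem_mul ?_ (hX i)
  rw [mem_vanishingIdeal_singleton_iff, aeval_eq_eval]
  have := h1 i
  simpa [Derivation.leibniz, pderiv_X, Pi.single_apply, apply_ite (eval p), Finset.sum_ite_eq] using this

lemma exists_gen_aux {K : Type} [Field K] {n : ℕ} (W : Set (Fin n → K)) (p : Fin n → K)
    (hp : p ∈ W) (h1 : tangentDimAt W p = 1) :
    ∃ x ∈ vanishingIdeal K {p}, ∀ f ∈ vanishingIdeal K {p}, ∃ c : K,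
      ∃ h ∈ vanishingIdeal K W, f - C c * x - h ∈ (vanishingIdeal K {p}) ^ 2 := by
  classical
  let D : MvPolynomial (Fin n) K →ₗ[K] Module.Dual K (Fin n → K) :=
    { toFun := fun f => 
        { toFun := fun y => ∑ i, eval p (pderiv i f) * y i
          map_add' := by intro a b; simp [mul_add, Finset.sum_add_distrib]
          map_smul' := by
            intro a b
            simp only [Pi.smul_apply, smul_eq_mul, RingHom.id_apply, Finset.mul_sum]
            exact Finset.sum_congr rfl fun i _ => by ring }
      map_add' := by intro a b; ext; simp [add_mul, Finset.sum_add_distrib]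
      map_smul' := by intro a b; ext; simp [smul_eval, Finset.mul_sum, mul_assoc] }
  let V : Submodule K (Module.Dual K (Fin n → K)) :=
    ((vanishingIdeal K W).restrictScalars K).map D
  have hT : (V.dualCoannihilator : Set (Fin n → K)) = tangentSpaceAt W p := by
    ext y
    simp only [SetLike.mem_coe, Submodule.mem_dualCoannihilator, tangentSpaceAt, Set.mem_ofPred_eq]
    constructor
    · intro h f hf
      exact h (D f) ⟨f, hf, rfl⟩
    · rintro h _ ⟨f, hf, rfl⟩
      exact h f hf
  unfold tangentDimAt at h1
  rw [← hT, Submodule.span_eq] at h1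
  obtain ⟨v, hv0, hv⟩ := finrank_eq_one_iff'.1 h1
  have hv0' : (v : Fin n → K) ≠ 0 := by simpa using hv0
  obtain ⟨j, hj⟩ := Function.ne_iff.1 hv0'
  simp only [Pi.zero_apply] at hj
  refine ⟨X j - C (p j), by rw [mem_vanishingIdeal_singleton_iff]; simp, fun f hf => ?_⟩
  set c : K := D f v / v.1 j with hc
  have hmem : D (f - C c * (X j - C (p j))) ∈ V := by
    rw [← Subspace.dualCoannihilator_dualAnnihilator_eq (W := V), Submodule.mem_dualAnnihilator]
    intro w hw
    obtain ⟨a, ha⟩ := hv ⟨w, hw⟩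
    have : w = a • (v : Fin n → K) := by rw [← Submodule.coe_smul, ha]
    rw [this, map_smul, map_sub, LinearMap.sub_apply]
    have : D (C c * (X j - C (p j))) (v : Fin n → K) = c * v.1 j := by
      simp [D, Derivation.leibniz, pderiv_X, Pi.single_apply, apply_ite (eval p)]
    rw [this, hc, div_mul_cancel₀ _ hj, sub_self, smul_zero]
  obtain ⟨h, hh, hD⟩ := hmem
  refine ⟨c, h, hh, taylor_aux p _ ?_ ?_⟩
  · have e1 : eval p f = 0 := by rw [← aeval_eq_eval]; exact hf p rfl
    have e2 : eval p h = 0 := by rw [← aeval_eq_eval]; exact hh p hp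
    simp [e1, e2]
  · intro i
    have := congrArg (fun φ : Module.Dual K (Fin n → K) => φ (Pi.single i 1)) hD
    simp only [D, LinearMap.coe_mk, AddHom.coe_mk, Pi.single_apply, mul_ite, mul_one, mul_zero, Finset.sum_ite_eq', Finset.mem_univ, if_true] at this
    rw [map_sub, map_sub, ← this, sub_self]


lemma loc_aux {A S : Type} [CommRing A] [CommRing S] [Algebra A S] [IsDomain S] [IsLocalRing S]
    [IsNoetherianRing S] (m : Ideal A) (x : A) (hx : x ∈ m)
    (hmax : m.map (algebraMap A S) = IsLocalRing.maximalIdeal S)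
    (hmm : m ≤ Ideal.span {x} ⊔ m * m) : IsIntegrallyClosed S := by
  have hprin : (IsLocalRing.maximalIdeal S).IsPrincipal := by
    refine ⟨algebraMap _ _ x, le_antisymm ?_ ?_⟩
    · apply Submodule.le_of_le_smul_of_le_jacobson_bot
        (I := IsLocalRing.maximalIdeal S)
      · exact IsNoetherian.noetherian _
      · exact IsLocalRing.maximalIdeal_le_jacobson _
      · have := Ideal.map_mono (f := algebraMap A S) hmm
        rw [Ideal.map_sup, Ideal.map_mul, Ideal.map_span, hmax, Set.image_singleton] at this
        exact this
    · rw [← Ideal.span, Ideal.span_singleton_le_iff_mem, ← hmax]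
      exact Ideal.mem_map_of_mem _ hx
  have h : IsIntegrallyClosed S ∧ ∀ P : Ideal S, P ≠ ⊥ → P.IsPrime →
      P = IsLocalRing.maximalIdeal S := ((tfae_of_isNoetherianRing_of_isLocalRing_of_isDomain S).out 4 3).1 hprin
  exact h.1

lemma intClosed_aux {K : Type} [Field K] [IsAlgClosed K] {n : ℕ}
    (W : Set (Fin n → K)) (hW : IsSmoothVariety W) (hd : varDim W = 1)
    (hz : W = zclosure W)
    (g : Fin n → Polynomial K)
    (hker : ∀ f : MvPolynomial (Fin n) K, f ∈ vanishingIdeal K W ↔ aeval g f = 0) :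
    IsIntegrallyClosed (aeval g : MvPolynomial (Fin n) K →ₐ[K] Polynomial K).range := by
  set φ : MvPolynomial (Fin n) K →ₐ[K] Polynomial K := aeval g with hφ
  have hsurj : Function.Surjective φ.rangeRestrict := φ.rangeRestrict_surjective
  have hN : IsNoetherianRing φ.range :=
    isNoetherianRing_of_surjective _ _ φ.rangeRestrict.toRingHom hsurj
  refine IsIntegrallyClosed.of_localization_maximal fun m _ hm => ?_
  have hcm : (m.comap φ.rangeRestrict).IsMaximal :=
    Ideal.comap_isMaximal_of_surjective _ hsurj
  obtain ⟨p, hp⟩ := isMaximal_iff_eq_vanishingIdeal_singleton.1 hcm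
  have hpW : p ∈ W := by
    rw [hz]
    intro f hf
    have : f ∈ vanishingIdeal K {p} := by
      rw [← hp, Ideal.mem_comap]
      have : φ.rangeRestrict f = 0 := Subtype.ext ((hker f).1 hf)
      rw [this]; exact m.zero_mem
    exact this p rfl
  obtain ⟨x, hx, hgen⟩ := exists_gen_aux W p hpW ((hW p hpW).trans hd)
  have hmm : m ≤ Ideal.span {φ.rangeRestrict x} ⊔ m * m := by
    intro a ha
    obtain ⟨f, rfl⟩ := hsurj a
    have hf : f ∈ vanishingIdeal K {p} := by rw [← hp]; exact ha
    obtain ⟨c, h, hh, hmem⟩ := hgen f hf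
    have h0 : φ.rangeRestrict h = 0 := Subtype.ext ((hker h).1 hh)
    have e : φ.rangeRestrict f = φ.rangeRestrict (C c) * φ.rangeRestrict x
        + φ.rangeRestrict (f - C c * x - h) := by
      simp only [map_sub, map_mul, h0]; ring
    rw [e]
    refine Ideal.add_mem _ (Ideal.mem_sup_left (Ideal.mul_mem_left _ _ (Ideal.mem_span_singleton_self _))) (Ideal.mem_sup_right ?_)
    have := Ideal.mem_map_of_mem φ.rangeRestrict hmem
    rw [← hp, pow_two, Ideal.map_mul, Ideal.map_comap_of_surjective _ hsurj] at this
    exact this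
  have hx' : φ.rangeRestrict x ∈ m := by
    have : x ∈ m.comap φ.rangeRestrict := by rw [hp]; exact hx
    exact this
  have hNL : IsNoetherianRing (Localization.AtPrime m) :=
      IsLocalization.isNoetherianRing m.primeCompl _ hN
  exact loc_aux m _ hx' (Localization.AtPrime.map_eq_maximalIdeal (I := m)) hmm

lemma exists_inverse_aux {K : Type} [Field K] [IsAlgClosed K] [CharZero K] {n : ℕ}
    (g : Fin n → Polynomial K)
    (hIC : IsIntegrallyClosed (aeval g : MvPolynomial (Fin n) K →ₐ[K] Polynomial K).range)
    (U : Set K) (hUopen : Uᶜ.Finite) 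
    (hP1 : Set.InjOn (fun t => fun i => (g i).eval t) U)
    (j : Fin n) (hj : 1 ≤ (g j).natDegree)
    (hP2 : ∀ t ∈ U, ∃ i, (g i).derivative.eval t ≠ 0) :
    ∃ Φ : MvPolynomial (Fin n) K, aeval g Φ = Polynomial.X := by
  classical
  set φ : MvPolynomial (Fin n) K →ₐ[K] Polynomial K := aeval g with hφ
  set A := φ.range with hA
  have hgA : ∀ i, g i ∈ A := fun i => ⟨X i, by simp [hφ]⟩
  let ι : K →+* A := algebraMap K A
  -- the polynomials g_i(X) - g_i over A
  let G : Fin n → Polynomial A := fun i => (g i).map ι - Polynomial.C ⟨g i, hgA i⟩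
  have hG : ∀ i, Polynomial.aeval (Polynomial.X : Polynomial K) (G i) = 0 := by
    intro i
    change Polynomial.aeval (Polynomial.X : Polynomial K) ((g i).map ι - Polynomial.C ⟨g i, hgA i⟩) = 0
    rw [Polynomial.aeval_sub, Polynomial.aeval_C]
    rw [Polynomial.aeval_map_algebraMap, Polynomial.aeval_X_left_apply]
    exact sub_self _
  have hint : IsIntegral A (Polynomial.X : Polynomial K) := by
    have hne : g j ≠ 0 := by rintro h; simp [h] at hj
    refine ⟨Polynomial.C (ι (g j).leadingCoeff⁻¹) * G j, ?_, ?_⟩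
    · have hdeg : ((g j).map ι).natDegree = (g j).natDegree :=
        Polynomial.natDegree_map_eq_of_injective ι.injective _
      apply Polynomial.monic_C_mul_of_mul_leadingCoeff_eq_one
      have : (G j).leadingCoeff = ι (g j).leadingCoeff := by
        rw [Polynomial.leadingCoeff_sub_of_degree_lt, Polynomial.leadingCoeff_map]
        refine lt_of_le_of_lt Polynomial.degree_C_le ?_
        rw [← Polynomial.natDegree_pos_iff_degree_pos, hdeg]
        exact hj
      rw [this, ← map_mul, inv_mul_cancel₀ (Polynomial.leadingCoeff_ne_zero.2 hne), map_one]
    · have := hG j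
      rw [Polynomial.eval₂_mul]
      rw [Polynomial.aeval_def] at this
      rw [this, mul_zero]
  set μ := minpoly A (Polynomial.X : Polynomial K) with hμ
  have hmon : μ.Monic := minpoly.monic hint
  have hdvd : ∀ i, μ ∣ G i := fun i => minpoly.isIntegrallyClosed_dvd hint (hG i)
  -- choose a good point
  have hfin : {τ : K | ∃ u ∈ Uᶜ, (g j).eval τ = (g j).eval u}.Finite := by
    have : {τ : K | ∃ u ∈ Uᶜ, (g j).eval τ = (g j).eval u} =
        ⋃ u ∈ Uᶜ, {τ | (g j).eval τ = (g j).eval u} := by ext; simp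
    rw [this]
    refine hUopen.biUnion fun u _ => ?_
    have hne : g j - Polynomial.C ((g j).eval u) ≠ 0 := by
      intro h
      rw [sub_eq_zero] at h
      rw [h, Polynomial.natDegree_C] at hj
      omega
    refine (Polynomial.finite_setOfPred_isRoot hne).subset ?_
    intro τ hτ
    simpa [Polynomial.IsRoot, sub_eq_zero] using hτ
  obtain ⟨τ, hτ⟩ := (hfin.infinite_compl).nonempty
  have hτU : τ ∈ U := by
    by_contra h
    exact hτ ⟨τ, h, rfl⟩
  have hτ' : ∀ s, (∀ i, (g i).eval s = (g i).eval τ) → s = τ := by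
    intro s hs
    have hsU : s ∈ U := by
      by_contra h
      exact hτ ⟨s, h, (hs j).symm⟩
    exact hP1 hsU hτU (funext hs)
  let ev : A →+* K := (Polynomial.evalRingHom τ).comp A.val.toRingHom
  have hevG : ∀ i, (G i).map ev = g i - Polynomial.C ((g i).eval τ) := by
    intro i
    simp only [G, Polynomial.map_sub, Polynomial.map_C, Polynomial.map_map]
    have : ev.comp ι = RingHom.id K := by
      ext a
      simp [ev, ι]
    rw [this, Polynomial.map_id]
    rfl
  have hdvd' : ∀ i, μ.map ev ∣ g i - Polynomial.C ((g i).eval τ) := fun i => by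
    rw [← hevG]; exact Polynomial.map_dvd ev (hdvd i)
  have hmon' := hmon.map ev
  have hsplit : (μ.map ev) = (Polynomial.X - Polynomial.C τ) ^ μ.natDegree := by
    have h1 := (IsAlgClosed.splits (μ.map ev)).eq_prod_roots_of_monic hmon'
    have h2 : (μ.map ev).roots = Multiset.replicate μ.natDegree τ := by
      rw [Multiset.eq_replicate]
      refine ⟨?_, ?_⟩
      · rw [← (IsAlgClosed.splits (μ.map ev)).natDegree_eq_card_roots, hmon.natDegree_map]
      · intro b hb
        have hb' := Polynomial.isRoot_of_mem_roots hb
        apply hτ'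
        intro i
        have := hb'.dvd (hdvd' i)
        simpa [Polynomial.IsRoot, sub_eq_zero] using this
    rw [h1, h2]
    simp
  have hdeg : μ.natDegree ≤ 1 := by
    by_contra hlt
    push Not at hlt
    obtain ⟨i, hi⟩ := hP2 τ hτU
    apply hi
    have h2 : (Polynomial.X - Polynomial.C τ) ^ 2 ∣ g i - Polynomial.C ((g i).eval τ) :=
      (pow_dvd_pow _ hlt).trans (hsplit ▸ hdvd' i)
    obtain ⟨q, hq⟩ := h2
    have := congrArg (fun f => (Polynomial.derivative f).eval τ) hq
    simpa [Polynomial.derivative_mul, Polynomial.derivative_pow] using this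
  have hdeg1 : μ.natDegree = 1 := le_antisymm hdeg (minpoly.natDegree_pos hint)
  have hX := minpoly.aeval A (Polynomial.X : Polynomial K)
  rw [← hμ, hmon.eq_X_add_C hdeg1] at hX
  simp only [map_add, Polynomial.aeval_X, Polynomial.aeval_C] at hX
  have hXA : (Polynomial.X : Polynomial K) ∈ A := by
    rw [eq_neg_of_add_eq_zero_left hX]
    exact A.neg_mem (μ.coeff 0).2
  exact hXA


lemma pencil_aux {K : Type} [Field K] [IsAlgClosed K] [CharZero K] (p q : Polynomial K)
    (hd : q.natDegree < p.natDegree) (hpq : ∀ t, p.eval t = 0 → q.eval t ≠ 0) :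
    ∃ β : K, β ≠ 0 ∧ (p + Polynomial.C β * q).natDegree = p.natDegree ∧
      (p + Polynomial.C β * q).roots.Nodup := by
  classical
  set W := p * q.derivative - p.derivative * q with hW
  have hcop : IsCoprime p q := by
    rw [Polynomial.isCoprime_iff_aeval_ne_zero_of_isAlgClosed K K]
    intro a
    simp only [Polynomial.coe_aeval_eq_eval]
    by_cases h : p.eval a = 0
    · exact Or.inr (hpq a h)
    · exact Or.inl h
  have hW0 : W ≠ 0 := by
    intro h
    rw [hW, sub_eq_zero] at h
    have h1 : p ∣ p.derivative := hcop.dvd_of_dvd_mul_right ⟨_, h.symm⟩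
    have h2 : p.derivative = 0 := by
      by_contra hne
      have h3 := Polynomial.natDegree_le_of_dvd h1 hne
      have h4 := Polynomial.natDegree_derivative_lt (p := p) (by omega)
      omega
    have := Polynomial.derivative_eq_zero.1 h2
    omega
  obtain ⟨β, hβ⟩ := Infinite.exists_notMem_finset
    (insert 0 (W.roots.toFinset.image fun t => - p.eval t / q.eval t))
  rw [Finset.mem_insert, not_or] at hβ
  have hdeg : (p + Polynomial.C β * q).natDegree = p.natDegree := by
    apply Polynomial.natDegree_add_eq_left_of_natDegree_lt
    exact lt_of_le_of_lt (Polynomial.natDegree_C_mul_le _ _) hd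
  refine ⟨β, hβ.1, hdeg, ?_⟩
  set F := p + Polynomial.C β * q with hF
  have hF0 : F ≠ 0 := by
    intro h; rw [h] at hdeg; simp at hdeg; omega
  rw [Multiset.nodup_iff_count_le_one]
  intro t
  rw [Polynomial.count_roots]
  by_contra hlt
  push Not at hlt
  rw [Polynomial.one_lt_rootMultiplicity_iff_isRoot hF0] at hlt
  obtain ⟨h1, h2⟩ := hlt
  simp only [hF, Polynomial.IsRoot, Polynomial.eval_add, Polynomial.eval_mul, Polynomial.eval_C,
    Polynomial.derivative_add, Polynomial.derivative_mul, Polynomial.derivative_C, zero_mul,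
    zero_add] at h1 h2
  apply hβ.2
  rw [Finset.mem_image]
  have hq : q.eval t ≠ 0 := by
    intro hq
    rw [hq, mul_zero, add_zero] at h1
    exact hpq t h1 hq
  refine ⟨t, ?_, ?_⟩
  · rw [Multiset.mem_toFinset, Polynomial.mem_roots hW0]
    simp only [hW, Polynomial.IsRoot, Polynomial.eval_sub, Polynomial.eval_mul]
    linear_combination (q.derivative.eval t) * h1 - q.eval t * h2
  · field_simp
    linear_combination -h1

/-- the polynomial obtained by applying a linear form to the parametrization. -/
noncomputable def linP {K : Type} [Field K] {n : ℕ} (g : Fin n → Polynomial K)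
    (a : Fin n → K) : Polynomial K := ∑ i, Polynomial.C (a i) * g i

lemma linP_eval {K : Type} [Field K] {n : ℕ} (g : Fin n → Polynomial K)
    (a : Fin n → K) (t : K) : (linP g a).eval t = ∑ i, a i * (g i).eval t := by
  simp [linP, Polynomial.eval_finsetSum]

lemma linP_deriv_eval {K : Type} [Field K] {n : ℕ} (g : Fin n → Polynomial K)
    (a : Fin n → K) (t : K) :
    (linP g a).derivative.eval t = ∑ i, a i * (g i).derivative.eval t := by
  simp [linP, Polynomial.eval_finsetSum]

lemma linP_natDegree {K : Type} [Field K] {n : ℕ} (g : Fin n → Polynomial K)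
    (a : Fin n → K) (d : ℕ) (hd : ∀ i, (g i).natDegree ≤ d) : (linP g a).natDegree ≤ d :=
  Polynomial.natDegree_sum_le_of_forall_le _ _ fun i _ =>
    (Polynomial.natDegree_C_mul_le _ _).trans (hd i)

lemma exists_forms_aux {K : Type} [Field K] {N k : ℕ} (L : AffineSubspace K (Fin N → K))
    (x0 : Fin N → K) (hx0 : x0 ∈ L)
    (hk : k ≤ N) (hL : Module.finrank K L.direction = N - k) :
    ∃ A : Fin k → Fin N → K, ∃ c : Fin k → K, ∀ x, x ∈ L ↔ ∀ j, ∑ i, A j i * x i = c j := by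
  have hq : Module.finrank K ((Fin N → K) ⧸ L.direction) = k := by
    have := Submodule.finrank_quotient_add_finrank L.direction
    rw [hL, Module.finrank_fin_fun] at this
    omega
  let e : ((Fin N → K) ⧸ L.direction) ≃ₗ[K] (Fin k → K) :=
    LinearEquiv.ofFinrankEq _ _ (by rw [hq, Module.finrank_fin_fun])
  let T : (Fin N → K) →ₗ[K] (Fin k → K) := e.toLinearMap ∘ₗ L.direction.mkQ
  refine ⟨LinearMap.toMatrix' T, T x0, fun x => ?_⟩
  have h1 : x ∈ L ↔ T x = T x0 := by
    have : x ∈ L ↔ x - x0 ∈ L.direction := by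
      rw [← vsub_eq_sub, AffineSubspace.vsub_right_mem_direction_iff_mem hx0]
    rw [this, ← sub_eq_zero, ← map_sub, LinearMap.comp_apply, Submodule.mkQ_apply]
    rw [LinearEquiv.coe_coe, LinearEquiv.map_eq_zero_iff, Submodule.Quotient.mk_eq_zero]
  rw [h1, _root_.funext_iff]
  refine forall_congr' fun j => ?_
  conv_lhs => rw [← LinearMap.toMatrix'_mulVec T x]
  rfl

lemma form_subspace_aux {K : Type} [Field K] {N k : ℕ} 
    (T : (Fin N → K) →ₗ[K] (Fin k → K)) (hT : Function.Surjective T) (c : Fin k → K) :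
    ∃ L : AffineSubspace K (Fin N → K), Module.finrank K L.direction = N - k ∧
      ∀ x, x ∈ L ↔ T x = c := by
  obtain ⟨x0, rfl⟩ := hT c
  refine ⟨AffineSubspace.mk' x0 (LinearMap.ker T), ?_, fun x => ?_⟩
  · rw [AffineSubspace.direction_mk']
    have := LinearMap.finrank_range_add_finrank_ker T
    rw [LinearMap.range_eq_top.2 hT, finrank_top, Module.finrank_fin_fun, Module.finrank_fin_fun] at this
    omega
  · rw [AffineSubspace.mem_mk', vsub_eq_sub, LinearMap.mem_ker, map_sub, sub_eq_zero]


lemma plane_aux {K : Type} [Field K] [Infinite K] (A B : Fin 2 → Polynomial K) (d : ℕ)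
    (hd : 1 ≤ d) (hA : ∀ j, (A j).natDegree ≤ d) (hB : ∀ j, (B j).natDegree ≤ d - 1)
    (hS : {u : K × K | ∀ j, (A j).eval u.1 + u.2 * (B j).eval u.1 = 0}.Finite) :
    {u : K × K | ∀ j, (A j).eval u.1 + u.2 * (B j).eval u.1 = 0}.ncard ≤ 2 * d - 1 := by
  classical
  set S := {u : K × K | ∀ j, (A j).eval u.1 + u.2 * (B j).eval u.1 = 0} with hSdef
  have hmem : ∀ u : K × K, u ∈ S ↔ ∀ j, (A j).eval u.1 + u.2 * (B j).eval u.1 = 0 :=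
    fun u => Iff.rfl
  have hno : ∀ u ∈ S, ¬ ∀ j, (B j).eval u.1 = 0 := by
    intro u hu hB0
    rw [hmem] at hu
    refine Set.infinite_univ (α := K) ((hS.preimage (f := fun s : K => (u.1, s)) ?_).subset ?_)
    · intro a _ b _ h
      exact (Prod.ext_iff.1 h).2
    · intro s _
      change (u.1, s) ∈ S
      rw [hmem]
      intro j
      have := hu j
      simp only [hB0 j, mul_zero] at this ⊢
      exact this
  set F := A 0 * B 1 - A 1 * B 0 with hF
  have hroot : ∀ u ∈ S, F.eval u.1 = 0 := by
    intro u hu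
    have h0 := hu 0
    have h1 := hu 1
    simp only [hF, Polynomial.eval_sub, Polynomial.eval_mul]
    linear_combination (B 1).eval u.1 * h0 - (B 0).eval u.1 * h1
  by_cases hF0 : F = 0
  · have : S = ∅ := by
      by_contra hne
      obtain ⟨u, hu⟩ := Set.nonempty_iff_ne_empty.2 hne
      have := hno u hu
      push Not at this
      obtain ⟨j, hj⟩ := this
      have hBj : B j ≠ 0 := by intro h; rw [h] at hj; simp at hj
      have hfin : {t | (B j).eval t ≠ 0}.Finite := by
        refine (hS.image Prod.fst).subset ?_
        intro t ht
        have ht : (B j).eval t ≠ 0 := ht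
        refine ⟨(t, -(A j).eval t / (B j).eval t), ?_, rfl⟩
        rw [hmem]
        intro l
        have hFt : (A 0).eval t * (B 1).eval t - (A 1).eval t * (B 0).eval t = 0 := by
          have := congrArg (Polynomial.eval t) hF0
          simpa [hF] using this
        simp only []
        field_simp
        fin_cases j <;> fin_cases l <;> simp <;> first | ring1 | linear_combination hFt | linear_combination -hFt
      have h2 := Polynomial.finite_setOfPred_isRoot hBj
      have := hfin.union h2
      refine Set.infinite_univ (α := K) (this.subset fun t _ => ?_)
      by_cases h : (B j).eval t = 0
      · exact Or.inr h
      · exact Or.inl h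
    rw [this]; simp
  · have h1 : S.ncard ≤ (F.roots.toFinset : Set K).ncard := by
      refine Set.ncard_le_ncard_of_injOn Prod.fst ?_ ?_ (Finset.finite_toSet _)
      · intro u hu
        rw [Finset.mem_coe, Multiset.mem_toFinset, Polynomial.mem_roots hF0]
        exact hroot u hu
      · intro u hu v hv huv
        have := hno u hu
        push Not at this
        obtain ⟨j, hj⟩ := this
        refine Prod.ext huv ?_
        have e1 := hu j
        have e2 := hv j
        rw [← huv] at e2
        apply mul_right_cancel₀ hj
        linear_combination e1 - e2
    rw [Set.ncard_coe_finset] at h1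
    have h2 := Multiset.toFinset_card_le F.roots
    have h3 := Polynomial.card_roots' F
    have h4 : F.natDegree ≤ 2 * d - 1 := by
      refine (Polynomial.natDegree_sub_le _ _).trans (max_le ?_ ?_)
      · have := Polynomial.natDegree_mul_le (p := A 0) (q := B 1)
        have := hA 0; have := hB 1; omega
      · have := Polynomial.natDegree_mul_le (p := A 1) (q := B 0)
        have := hA 1; have := hB 0; omega
    omega

section
variable {K : Type} [Field K] {n : ℕ} (g : Fin n → Polynomial K)

lemma eval_aeval_aux (f : MvPolynomial (Fin n) K) (t : K) :
    (aeval g f).eval t = eval (fun i => (g i).eval t) f := by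
  induction f using MvPolynomial.induction_on with
  | C a => simp
  | add p q hp hq => simp only [map_add, hp, hq, Polynomial.eval_add]
  | mul_X p i hp => simp only [map_mul, hp, Polynomial.eval_mul, aeval_X, eval_X]

lemma chain_aux (f : MvPolynomial (Fin n) K) (t : K) :
    ∑ i, eval (fun i => (g i).eval t) (pderiv i f) * (g i).derivative.eval t
      = (aeval g f).derivative.eval t := by
  classical
  induction f using MvPolynomial.induction_on with
  | C a => simp
  | add p q hp hq =>
    simp only [map_add, Polynomial.eval_add, ← hp, ← hq, add_mul, Finset.sum_add_distrib]
  | mul_X p i hp =>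
    simp only [map_mul, aeval_X, Polynomial.derivative_mul, Polynomial.eval_add,
      Polynomial.eval_mul, ← hp, eval_aeval_aux, Derivation.leibniz, pderiv_X, smul_eq_mul, map_add,
      eval_X, add_mul, Finset.sum_add_distrib, Pi.single_apply, apply_ite (eval _), map_one, map_zero,
      mul_ite, ite_mul, mul_one, mul_zero, zero_mul, Finset.sum_ite_eq', Finset.sum_ite_eq, Finset.mem_univ, if_true]
    rw [Finset.sum_mul, add_comm]
    congr 1
    exact Finset.sum_congr rfl fun j _ => by ring

lemma Phi_P (Φ : MvPolynomial (Fin n) K)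
    (hΦ : aeval g Φ = Polynomial.X) (t : K) : eval (fun i => (g i).eval t) Φ = t := by
  rw [← eval_aeval_aux, hΦ, Polynomial.eval_X]

lemma Phi_P' (Φ : MvPolynomial (Fin n) K)
    (hΦ : aeval g Φ = Polynomial.X) (t : K) :
    ∑ i, eval (fun i => (g i).eval t) (pderiv i Φ) * (g i).derivative.eval t = 1 := by
  rw [chain_aux, hΦ]; simp

lemma rel_mem (Φ : MvPolynomial (Fin n) K)
    (hΦ : aeval g Φ = Polynomial.X) (W : Set (Fin n → K))
    (hker : ∀ f : MvPolynomial (Fin n) K, f ∈ vanishingIdeal K W ↔ aeval g f = 0)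
    (i : Fin n) : X i - Polynomial.aeval Φ (g i) ∈ vanishingIdeal K W := by
  rw [hker, map_sub, aeval_X, ← Polynomial.aeval_algHom_apply, hΦ, Polynomial.aeval_X_left_apply,
    sub_self]

lemma mem_C_iff (Φ : MvPolynomial (Fin n) K)
    (hΦ : aeval g Φ = Polynomial.X) (W : Set (Fin n → K)) (hz : W = zclosure W)
    (hker : ∀ f : MvPolynomial (Fin n) K, f ∈ vanishingIdeal K W ↔ aeval g f = 0)
    (x : Fin n → K) : x ∈ W ↔ ∃ t, x = fun i => (g i).eval t := by
  constructor
  · intro hx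
    refine ⟨aeval x Φ, funext fun i => ?_⟩
    have := rel_mem g Φ hΦ W hker i x hx
    rw [map_sub, aeval_X, ← Polynomial.aeval_algHom_apply, sub_eq_zero] at this
    rw [this, Polynomial.coe_aeval_eq_eval]
  · rintro ⟨t, rfl⟩
    rw [hz]
    intro f hf
    rw [aeval_eq_eval, ← eval_aeval_aux, (hker f).1 hf, Polynomial.eval_zero]

lemma mem_T_iff (Φ : MvPolynomial (Fin n) K)
    (hΦ : aeval g Φ = Polynomial.X) (W : Set (Fin n → K))
    (hker : ∀ f : MvPolynomial (Fin n) K, f ∈ vanishingIdeal K W ↔ aeval g f = 0)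
    (t : K) (y : Fin n → K) :
    y ∈ tangentSpaceAt W (fun i => (g i).eval t) ↔
      ∃ s, y = fun i => s * (g i).derivative.eval t := by
  classical
  constructor
  · intro hy
    refine ⟨∑ j, eval (fun i => (g i).eval t) (pderiv j Φ) * y j, funext fun i => ?_⟩
    have := hy _ (rel_mem g Φ hΦ W hker i)
    simp only [map_sub, pderiv_X, Derivation.map_aeval, Pi.single_apply, apply_ite (eval _),
      map_one, map_zero, sub_mul, ite_mul, one_mul, zero_mul, Finset.sum_sub_distrib, smul_eq_mul,
      map_mul, Finset.sum_ite_eq', Finset.sum_ite_eq, Finset.mem_univ, if_true, sub_eq_zero] at this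
    rw [this, Finset.sum_mul]
    refine Finset.sum_congr rfl fun j _ => ?_
    have e : eval (fun i => (g i).eval t) (Polynomial.aeval Φ (g i).derivative)
        = (g i).derivative.eval t := by
      rw [← aeval_eq_eval, ← Polynomial.aeval_algHom_apply, aeval_eq_eval, Phi_P g Φ hΦ, Polynomial.coe_aeval_eq_eval]
    rw [e]; ring
  · rintro ⟨s, rfl⟩ f hf
    have := chain_aux g f t
    rw [(hker f).1 hf] at this
    simp only [Polynomial.derivative_zero, Polynomial.eval_zero] at this
    rw [← mul_zero s, ← this, Finset.mul_sum]
    exact Finset.sum_congr rfl fun i _ => by ring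

/-- Parametrization of the tangent bundle. -/
noncomputable def parT (u : K × K) : Fin (n + n) → K :=
  Fin.append (fun i => (g i).eval u.1) (fun i => u.2 * (g i).derivative.eval u.1)

lemma parT_left (u : K × K) (i : Fin n) :
    parT g u (Fin.castAdd n i) = (g i).eval u.1 := by
  unfold parT; rw [Fin.append_left]

lemma parT_right (u : K × K) (i : Fin n) :
    parT g u (Fin.natAdd n i) = u.2 * (g i).derivative.eval u.1 := by
  unfold parT; rw [Fin.append_right]

lemma mem_TC_iff (Φ : MvPolynomial (Fin n) K)
    (hΦ : aeval g Φ = Polynomial.X) (W : Set (Fin n → K)) (hz : W = zclosure W)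
    (hker : ∀ f : MvPolynomial (Fin n) K, f ∈ vanishingIdeal K W ↔ aeval g f = 0)
    (z : Fin (n + n) → K) : z ∈ tangentBundle W ↔ ∃ u, z = parT g u := by
  constructor
  · rintro ⟨h1, h2⟩
    obtain ⟨t, ht⟩ := (mem_C_iff g Φ hΦ W hz hker _).1 h1
    rw [ht, mem_T_iff g Φ hΦ W hker] at h2
    obtain ⟨s, hs⟩ := h2
    refine ⟨(t, s), ?_⟩
    unfold parT
    simp only []
    rw [← ht, ← hs]
    exact (Fin.append_castAdd_natAdd (f := z)).symm
  · rintro ⟨u, rfl⟩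
    have e1 : fstProj (parT g u) = fun i => (g i).eval u.1 := by
      funext i; exact parT_left g u i
    have e2 : sndProj (parT g u) = fun i => u.2 * (g i).derivative.eval u.1 := by
      funext i; exact parT_right g u i
    refine ⟨?_, ?_⟩
    · rw [e1]; exact (mem_C_iff g Φ hΦ W hz hker _).2 ⟨_, rfl⟩
    · rw [e1, e2]; exact (mem_T_iff g Φ hΦ W hker _ _).2 ⟨_, rfl⟩

lemma parT_inj (Φ : MvPolynomial (Fin n) K)
    (hΦ : aeval g Φ = Polynomial.X) : Function.Injective (parT g) := by
  rintro ⟨t, s⟩ ⟨t', s'⟩ h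
  have h1 : ∀ i, (g i).eval t = (g i).eval t' := by
    intro i
    have := congrFun h (Fin.castAdd n i)
    rwa [parT_left, parT_left] at this
  have h2 : ∀ i, s * (g i).derivative.eval t = s' * (g i).derivative.eval t' := by
    intro i
    have := congrFun h (Fin.natAdd n i)
    rwa [parT_right, parT_right] at this
  have ht : t = t' := by
    rw [← Phi_P g Φ hΦ t, ← Phi_P g Φ hΦ t', _root_.funext h1]
  subst ht
  refine Prod.ext rfl ?_
  simp only
  have e := Phi_P' g Φ hΦ t
  rw [← mul_one s, ← mul_one s', ← e, Finset.mul_sum, Finset.mul_sum]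
  refine Finset.sum_congr rfl fun i _ => ?_
  linear_combination (eval (fun i => (g i).eval t) (pderiv i Φ)) * h2 i

lemma varDim_TC (Φ : MvPolynomial (Fin n) K)
    (hΦ : aeval g Φ = Polynomial.X) (W : Set (Fin n → K)) (hz : W = zclosure W)
    (hker : ∀ f : MvPolynomial (Fin n) K, f ∈ vanishingIdeal K W ↔ aeval g f = 0)
    [Infinite K] : varDim (tangentBundle W) = 2 := by
  let ψ : MvPolynomial (Fin (n + n)) K →ₐ[K] MvPolynomial (Fin 2) K :=
    aeval (Fin.append (fun i => Polynomial.aeval (X 0) (g i))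
      (fun i => X 1 * Polynomial.aeval (X 0) (g i).derivative))
  have hψ : ∀ (f : MvPolynomial (Fin (n + n)) K) (x : Fin 2 → K),
      eval x (ψ f) = aeval (parT g (x 0, x 1)) f := by
    intro f x
    rw [← aeval_eq_eval]
    change ((aeval x).comp ψ) f = _
    congr 1
    apply MvPolynomial.algHom_ext
    intro i
    refine Fin.addCases (fun i => ?_) (fun i => ?_) i
    · rw [AlgHom.comp_apply, aeval_X, aeval_X, Fin.append_left, parT_left,
        ← Polynomial.aeval_algHom_apply, aeval_X, Polynomial.coe_aeval_eq_eval]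
    · rw [AlgHom.comp_apply, aeval_X, aeval_X, Fin.append_right, parT_right, map_mul,
        ← Polynomial.aeval_algHom_apply, aeval_X, aeval_X, Polynomial.coe_aeval_eq_eval]
  have hk : vanishingIdeal K (tangentBundle W) = RingHom.ker ψ := by
    ext f
    rw [RingHom.mem_ker]
    constructor
    · intro h
      apply MvPolynomial.funext
      intro x
      rw [hψ, map_zero]
      exact h _ ((mem_TC_iff g Φ hΦ W hz hker _).2 ⟨_, rfl⟩)
    · intro h z hz'
      obtain ⟨u, rfl⟩ := (mem_TC_iff g Φ hΦ W hz hker _).1 hz'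
      have := hψ f ![u.1, u.2]
      rw [h, map_zero] at this
      simpa using this.symm
  have hren : ∀ f : MvPolynomial (Fin n) K, ψ (rename (Fin.castAdd n) f) =
      Polynomial.aeval (X 0) (aeval g f) := by
    intro f
    change (ψ.comp (rename (Fin.castAdd n))) f = ((Polynomial.aeval (X 0)).comp (aeval g)) f
    congr 1
    apply MvPolynomial.algHom_ext
    intro i
    simp only [ψ, AlgHom.comp_apply, rename_X, aeval_X, Fin.append_left]
  have h0 : (X 0 : MvPolynomial (Fin 2) K) ∈ ψ.range :=
    ⟨rename (Fin.castAdd n) Φ, by 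
      change ψ _ = _
      rw [hren, hΦ, Polynomial.aeval_X]⟩
  have h1 : (X 1 : MvPolynomial (Fin 2) K) ∈ ψ.range := by
    refine ⟨∑ i, rename (Fin.castAdd n) (pderiv i Φ) * X (Fin.natAdd n i), ?_⟩
    change ψ _ = _
    apply MvPolynomial.funext
    intro x
    rw [hψ, map_sum]
    have := Phi_P' g Φ hΦ (x 0)
    have e1 : x 1 = x 1 * 1 := (mul_one _).symm
    rw [← this, Finset.mul_sum] at e1
    rw [eval_X]
    refine Eq.trans ?_ e1.symm
    refine Finset.sum_congr rfl fun i _ => ?_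
    rw [map_mul, aeval_rename, aeval_X]
    have : (parT g (x 0, x 1)) ∘ Fin.castAdd n = fun i => (g i).eval (x 0) := by
      funext i; exact parT_left g _ i
    rw [this, aeval_eq_eval]
    rw [parT_right]
    ring
  have hs : Function.Surjective ψ := by
    rw [← AlgHom.range_eq_top, eq_top_iff, ← MvPolynomial.adjoin_range_X, Algebra.adjoin_le_iff]
    rintro _ ⟨i, rfl⟩
    fin_cases i
    · exact h0
    · exact h1
  unfold varDim
  rw [hk, ringKrullDim_eq_of_ringEquiv (Ideal.quotientKerAlgEquivOfSurjective hs).toRingEquiv,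
    MvPolynomial.ringKrullDim_of_isNoetherianRing, ringKrullDim_eq_zero_of_field]
  simp

end


lemma geomDegree_C_aux {K : Type} [Field K] [IsAlgClosed K] [CharZero K] {n : ℕ}
    (W : Set (Fin n → K)) (g : Fin n → Polynomial K)
    (hW : ∀ x, x ∈ W ↔ ∃ t, x = fun i => (g i).eval t)
    (hinj : Function.Injective fun t : K => fun i => (g i).eval t)
    (hdim : varDim W = 1) (d : ℕ) (hd : 1 ≤ d) (hgd : ∀ i, (g i).natDegree ≤ d)
    (j : Fin n) (hj : (g j).natDegree = d) : geomDegree W = d := by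
  classical
  have hn : 1 ≤ n := by have := j.2; omega
  have hWi : ∀ L : AffineSubspace K (Fin n → K), W ∩ (L : Set (Fin n → K)) =
      (fun t : K => fun i => (g i).eval t) '' {t | (fun i => (g i).eval t) ∈ L} := by
    intro L
    ext x
    simp only [Set.mem_inter_iff, hW, Set.mem_image, SetLike.mem_coe]
    constructor
    · rintro ⟨⟨t, rfl⟩, h⟩; exact ⟨t, h, rfl⟩
    · rintro ⟨t, h, rfl⟩; exact ⟨⟨t, rfl⟩, h⟩
  unfold geomDegree
  rw [hdim]
  apply IsGreatest.csSup_eq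
  constructor
  · obtain ⟨β, -, hdeg, hnod⟩ := pencil_aux (g j) 1 (by simp; omega) (by simp)
    obtain ⟨L, hL, hLm⟩ := form_subspace_aux (k := 1)
      (LinearMap.pi fun _ => LinearMap.proj (R := K) (φ := fun _ : Fin n => K) j)
      (fun c => ⟨fun _ => c 0, by ext i; simp [Subsingleton.elim i 0]⟩) (fun _ => -β)
    have hF0 : g j + Polynomial.C β * 1 ≠ 0 := by
      intro h; rw [h] at hdeg; simp at hdeg; omega
    have hset : {t | (fun i => (g i).eval t) ∈ L} =
        ((g j + Polynomial.C β * 1).roots.toFinset : Set K) := by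
      ext t
      simp only [Finset.mem_coe, Multiset.mem_toFinset, Polynomial.mem_roots hF0]
      change _ ∈ L ↔ _
      rw [hLm, _root_.funext_iff]
      simp [Polynomial.IsRoot, eq_neg_iff_add_eq_zero]
    refine ⟨L, hL, ?_, ?_⟩
    · rw [hWi, hset]; exact (Finset.finite_toSet _).image _
    · rw [hWi, Set.ncard_image_of_injective _ hinj, hset, Set.ncard_coe_finset,
        Multiset.toFinset_card_of_nodup hnod,
        ← (IsAlgClosed.splits _).natDegree_eq_card_roots, hdeg, hj]
  · rintro m ⟨L, hL, hfin, rfl⟩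
    by_cases hne : (L : Set (Fin n → K)).Nonempty
    · obtain ⟨x0, hx0⟩ := hne
      obtain ⟨A, c, hA⟩ := exists_forms_aux L x0 hx0 hn hL
      rw [hWi] at hfin ⊢
      rw [Set.ncard_image_of_injective _ hinj]
      have hfin' := hfin.of_finite_image hinj.injOn
      set F := linP g (A 0) - Polynomial.C (c 0) with hF
      have hset : {t | (fun i => (g i).eval t) ∈ L} = {t | F.IsRoot t} := by
        ext t
        change _ ∈ L ↔ F.IsRoot t
        rw [hA]
        simp [hF, Polynomial.IsRoot, linP_eval, sub_eq_zero]
      rw [hset] at hfin' ⊢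
      have hF0 : F ≠ 0 := by
        intro h
        rw [h] at hfin'
        exact Set.infinite_univ (α := K) (hfin'.subset fun t _ => by simp [Polynomial.IsRoot])
      have : {t | F.IsRoot t} = (F.roots.toFinset : Set K) := by
        ext t; simp [hF0]
      rw [this, Set.ncard_coe_finset]
      refine (Multiset.toFinset_card_le _).trans ((Polynomial.card_roots' _).trans ?_)
      refine (Polynomial.natDegree_sub_le _ _).trans (max_le (linP_natDegree g _ d hgd) ?_)
      simp
    · rw [Set.not_nonempty_iff_eq_empty] at hne
      rw [hne]; simp

lemma geomDegree_TC_aux {K : Type} [Field K] [IsAlgClosed K] [CharZero K] {n : ℕ}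
    (W : Set (Fin (n + n) → K)) (g : Fin n → Polynomial K)
    (hW : ∀ x, x ∈ W ↔ ∃ u, x = parT g u)
    (hinj : Function.Injective (parT g))
    (hP' : ∀ t, ∃ i, (g i).derivative.eval t ≠ 0)
    (hdim : varDim W = 2) (d : ℕ) (hd : 1 ≤ d) (hgd : ∀ i, (g i).natDegree ≤ d)
    (j : Fin n) (hj : (g j).natDegree = d) : geomDegree W = 2 * d - 1 := by
  classical
  have hn : 2 ≤ n + n := by have := j.2; omega
  have hWi : ∀ L : AffineSubspace K (Fin (n + n) → K), W ∩ (L : Set (Fin (n + n) → K)) =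
      parT g '' {u | parT g u ∈ L} := by
    intro L
    ext x
    simp only [Set.mem_inter_iff, hW, Set.mem_image, SetLike.mem_coe]
    constructor
    · rintro ⟨⟨t, rfl⟩, h⟩; exact ⟨t, h, rfl⟩
    · rintro ⟨t, h, rfl⟩; exact ⟨⟨t, rfl⟩, h⟩
  have hsum : ∀ (a : Fin (n + n) → K) (u : K × K), ∑ i, a i * parT g u i =
      (linP g fun i => a (Fin.castAdd n i)).eval u.1 +
        u.2 * (linP g fun i => a (Fin.natAdd n i)).derivative.eval u.1 := by
    intro a u
    rw [Fin.sum_univ_add, linP_eval, linP_deriv_eval, Finset.mul_sum]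
    congr 1
    · exact Finset.sum_congr rfl fun i _ => by rw [parT_left]
    · exact Finset.sum_congr rfl fun i _ => by rw [parT_right]; ring
  unfold geomDegree
  rw [hdim]
  apply IsGreatest.csSup_eq
  constructor
  · set E := g j with hE
    have hE' : E.derivative.natDegree = d - 1 := by
      rw [Polynomial.natDegree_derivative, hj]
    have hE0 : E ≠ 0 := by intro h; rw [h] at hj; simp at hj; omega
    have hE'0 : E.derivative ≠ 0 := by
      intro h; rw [Polynomial.derivative_eq_zero] at h; omega
    have hEd : (E * E.derivative).natDegree = 2 * d - 1 := by
      rw [Polynomial.natDegree_mul hE0 hE'0, hE', hj]; omega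
    -- choose `b`
    obtain ⟨b, hb⟩ : ∃ b : Fin n → K, ∀ t, (E * E.derivative).eval t = 0 →
        (linP g b).derivative.eval t ≠ 0 := by
      let R := (E * E.derivative).roots.toFinset
      let ev : K → (Fin n → K) →ₗ[K] K := fun t =>
        { toFun := fun b => (linP g b).derivative.eval t
          map_add' := by intro x y; simp [linP_deriv_eval, add_mul, Finset.sum_add_distrib]
          map_smul' := by intro x y; simp [linP_deriv_eval, Finset.mul_sum, mul_assoc] }
      by_contra hcon
      push Not at hcon
      have hcov : ⋃ t : R, (LinearMap.ker (ev t) : Set (Fin n → K)) = Set.univ := by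
        rw [Set.eq_univ_iff_forall]
        intro b
        obtain ⟨t, ht, ht'⟩ := hcon b
        rw [Set.mem_iUnion]
        refine ⟨⟨t, ?_⟩, ?_⟩
        · rw [Multiset.mem_toFinset, Polynomial.mem_roots (mul_ne_zero hE0 hE'0)]; exact ht
        · exact ht'
      obtain ⟨t, ht⟩ := Subspace.exists_eq_top_of_iUnion_eq_univ hcov
      obtain ⟨i, hi⟩ := hP' t
      apply hi
      have : Pi.single i 1 ∈ LinearMap.ker (ev t) := by rw [ht]; trivial
      rw [LinearMap.mem_ker] at this
      simpa [ev, linP_deriv_eval, Pi.single_apply] using this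
    set B := (linP g b).derivative with hB
    have hBd : B.natDegree ≤ d - 1 := by
      have := linP_natDegree g b d hgd
      refine (Polynomial.natDegree_derivative_le _).trans (by omega)
    have hBdlt : B.natDegree < (E * E.derivative).natDegree := by
      rw [hEd]; omega
    obtain ⟨β, hβ, hdeg, hnod⟩ := pencil_aux (E * E.derivative) B hBdlt hb
    set F := E * E.derivative + Polynomial.C β * B with hF
    have hF0 : F ≠ 0 := by
      intro h; rw [h, hEd] at hdeg; simp at hdeg; omega
    let φ : Fin 2 → Fin (n + n) → K :=
      ![Fin.append (Pi.single j 1) b, Fin.append 0 (Pi.single j 1)]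
    let T : (Fin (n + n) → K) →ₗ[K] (Fin 2 → K) := Matrix.mulVecLin (Matrix.of φ)
    have hT0 : ∀ x, T x 0 = ∑ i, (Fin.append (Pi.single j 1) b : Fin (n + n) → K) i * x i := fun x => rfl
    have hT1 : ∀ x, T x 1 = ∑ i, (Fin.append 0 (Pi.single j 1) : Fin (n + n) → K) i * x i := fun x => rfl
    have hTs : Function.Surjective T := by
      intro c
      refine ⟨Fin.append (Pi.single j (c 0 - b j * c 1)) (Pi.single j (c 1)), ?_⟩
      funext l
      fin_cases l
      · change T _ 0 = c 0
        rw [hT0, Fin.sum_univ_add]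
        simp only [Fin.append_left, Fin.append_right]
        simp [Pi.single_apply]
      · change T _ 1 = c 1
        rw [hT1, Fin.sum_univ_add]
        simp only [Fin.append_left, Fin.append_right]
        simp [Pi.single_apply]
    obtain ⟨L, hL, hLm⟩ := form_subspace_aux T hTs ![0, β]
    have hsingle : linP g (Pi.single j 1) = E := by
      simp [linP, Pi.single_apply, hE, apply_ite Polynomial.C]
    have hmem : ∀ u : K × K, parT g u ∈ L ↔
        E.eval u.1 + u.2 * B.eval u.1 = 0 ∧ u.2 * E.derivative.eval u.1 = β := by
      intro u
      rw [hLm, _root_.funext_iff, Fin.forall_fin_two, hT0, hT1, hsum, hsum]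
      simp only [Fin.append_left, Fin.append_right]
      have h0 : linP g (fun i => (0 : Fin n → K) i) = 0 := by simp [linP]
      change (linP g (Pi.single j 1)).eval u.1 + u.2 * (linP g b).derivative.eval u.1 = 0 ∧
        (linP g (fun i => (0 : Fin n → K) i)).eval u.1 + u.2 * (linP g (Pi.single j 1)).derivative.eval u.1 = β ↔ _
      rw [hsingle, h0, Polynomial.eval_zero, zero_add]
    have hset : {u | parT g u ∈ L} =
        (fun t => (t, β / E.derivative.eval t)) '' (F.roots.toFinset : Set K) := by
      ext ⟨t, s⟩
      change parT g (t, s) ∈ L ↔ _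
      rw [hmem]
      simp only [Set.mem_image, Finset.mem_coe, Multiset.mem_toFinset, Polynomial.mem_roots hF0,
        Polynomial.IsRoot, Prod.mk.injEq]
      have hFe : ∀ t, F.eval t = E.eval t * E.derivative.eval t + β * B.eval t := by
        intro t; simp [hF]
      constructor
      · rintro ⟨h1, h2⟩
        have hne : E.derivative.eval t ≠ 0 := by
          intro h; rw [h, mul_zero] at h2; exact hβ h2.symm
        refine ⟨t, ?_, rfl, ?_⟩
        · rw [hFe]
          linear_combination E.derivative.eval t * h1 - B.eval t * h2
        · rw [div_eq_iff hne, h2]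
      · rintro ⟨t', h, rfl, rfl⟩
        have hne : E.derivative.eval t' ≠ 0 := by
          intro h'
          rw [hFe, h', mul_zero, zero_add] at h
          refine hb t' (by simp [h']) ?_
          exact (mul_eq_zero.1 h).resolve_left hβ
        rw [hFe] at h
        refine ⟨?_, div_mul_cancel₀ _ hne⟩
        field_simp
        linear_combination h
    refine ⟨L, hL, ?_, ?_⟩
    · rw [hWi, hset]; exact ((Finset.finite_toSet _).image _).image _
    · rw [hWi, Set.ncard_image_of_injective _ hinj, hset,
        Set.ncard_image_of_injective _ (fun a b h => (Prod.ext_iff.1 h).1), Set.ncard_coe_finset,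
        Multiset.toFinset_card_of_nodup hnod,
        ← (IsAlgClosed.splits _).natDegree_eq_card_roots, hdeg, hEd]
  · rintro m ⟨L, hL, hfin, rfl⟩
    by_cases hne : (L : Set (Fin (n + n) → K)).Nonempty
    · obtain ⟨x0, hx0⟩ := hne
      obtain ⟨A, c, hA⟩ := exists_forms_aux L x0 hx0 hn hL
      rw [hWi] at hfin ⊢
      rw [Set.ncard_image_of_injective _ hinj]
      have hfin' := hfin.of_finite_image hinj.injOn
      have hset : {u | parT g u ∈ L} = {u : K × K | ∀ l,
          ((fun l => linP g (fun i => A l (Fin.castAdd n i)) - Polynomial.C (c l)) l).eval u.1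
          + u.2 * ((fun l => (linP g (fun i => A l (Fin.natAdd n i))).derivative) l).eval u.1 = 0} := by
        ext u
        change _ ∈ L ↔ ∀ l, _
        rw [hA]
        refine forall_congr' fun l => ?_
        rw [hsum, ← sub_eq_zero]
        simp only [Polynomial.eval_sub, Polynomial.eval_C]
        rw [sub_add_eq_add_sub]
      rw [hset] at hfin' ⊢
      refine plane_aux _ _ d hd ?_ ?_ hfin'
      · intro l
        refine (Polynomial.natDegree_sub_le _ _).trans (max_le (linP_natDegree g _ d hgd) ?_)
        simp
      · intro l
        have := linP_natDegree g (fun i => A l (Fin.natAdd n i)) d hgd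
        refine (Polynomial.natDegree_derivative_le _).trans (by omega)
    · rw [Set.not_nonempty_iff_eq_empty] at hne
      rw [hne]; simp

/-- For a smooth algebraic curve `C ⊆ A^n` with a polynomial parametric representation
satisfying (P1) and (P2), `deg(TC) = 2·deg(C) − 1`. -/
theorem degree_tangentBundle_poly_param {K : Type} [Field K] [IsAlgClosed K] [CharZero K]
    {n : ℕ} (C : Set (Fin n → K)) (hC : IsSmoothCurve C)
    (g : Fin n → Polynomial K)
    (hdom : C = zclosure (Set.range fun t => fun i => (g i).eval t))
    (U : Set K) (hUopen : Uᶜ.Finite) (hUne : U.Nonempty)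
    (hP1 : Set.InjOn (fun t => fun i => (g i).eval t) U)
    (hP2 : ∀ t ∈ U, ∃ i, (g i).derivative.eval t ≠ 0) :
    geomDegree (tangentBundle C) = 2 * geomDegree C - 1 := by
  classical
  obtain ⟨hirr, hdim, hsm⟩ := hC
  have hker := ker_eq_aux C g hdom
  have hz : C = zclosure C := by
    apply Set.Subset.antisymm
    · intro x hx f hf
      exact hf x hx
    · intro x hx
      rw [hdom]
      intro f hf
      apply hx
      rw [hdom]
      intro y hy
      exact hy f hf
  obtain ⟨t0, ht0⟩ := hUne
  obtain ⟨i0, hi0⟩ := hP2 t0 ht0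
  have hi0d : 1 ≤ (g i0).natDegree := by
    by_contra h
    have : (g i0).natDegree = 0 := by omega
    rw [← Polynomial.derivative_eq_zero] at this
    simp [this] at hi0
  have : Nonempty (Fin n) := ⟨i0⟩
  obtain ⟨j, hj⟩ := Finite.exists_max fun i => (g i).natDegree
  have hjd : 1 ≤ (g j).natDegree := hi0d.trans (hj i0)
  have hIC := intClosed_aux C hsm hdim hz g hker
  obtain ⟨Φ, hΦ⟩ := exists_inverse_aux g hIC U hUopen hP1 j hjd hP2
  have hP' : ∀ t, ∃ i, (g i).derivative.eval t ≠ 0 := by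
    intro t
    by_contra h
    push Not at h
    have := Phi_P' g Φ hΦ t
    simp [h] at this
  have hinj : Function.Injective fun t : K => fun i => (g i).eval t := by
    intro a b h
    have h : (fun i => (g i).eval a) = fun i => (g i).eval b := h
    rw [← Phi_P g Φ hΦ a, ← Phi_P g Φ hΦ b, h]
  rw [geomDegree_C_aux C g (mem_C_iff g Φ hΦ C hz hker) hinj hdim _ hjd hj j rfl,
    geomDegree_TC_aux (tangentBundle C) g (mem_TC_iff g Φ hΦ C hz hker) (parT_inj g Φ hΦ) hP'
      (varDim_TC g Φ hΦ C hz hker) _ hjd hj j rfl]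
end

section
/- Let C ⊆ A^n be a smooth algebraic curve having a rational parametric representation that satisfies conditions (P1) and (P2). Then deg(TC) ≤ 3·deg(C) − 2. -/
open MvPolynomial

open MvPolynomial

namespace RatTB

section dim
variable {R S : Type} [CommRing R] [CommRing S]

lemma ringKrullDim_quot_ker_eq (f : R →+* S) (hf : f.IsIntegral) :
    ringKrullDim (R ⧸ RingHom.ker f) = ringKrullDim S := by
  have hinj : Function.Injective f.kerLift := RingHom.kerLift_injective f
  have hIntg : f.kerLift.IsIntegral := by
    intro x
    have h1 : (f.kerLift.comp (Ideal.Quotient.mk _)).IsIntegralElem x := by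
      have : f.kerLift.comp (Ideal.Quotient.mk _) = f := by ext; simp
      rw [this]; exact hf x
    exact RingHom.IsIntegralElem.of_comp h1
  generalize f.kerLift = g at hinj hIntg
  algebraize [g]
  have hI : Algebra.IsIntegral (R ⧸ RingHom.ker f) S := ⟨hIntg⟩
  have hF : FaithfulSMul (R ⧸ RingHom.ker f) S :=
    (faithfulSMul_iff_algebraMap_injective _ _).2 hinj
  apply le_antisymm
  · refine iSup_le fun l => ?_
    obtain ⟨⟨P, hP, hl⟩⟩ := Ideal.nonempty_primesOver (S := S) (RelSeries.head l).asIdeal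
    obtain ⟨L, hL, -⟩ := Ideal.exists_ltSeries_of_hasGoingUp (S := S) l P
    rw [← hL]
    exact le_iSup (fun p : LTSeries (PrimeSpectrum S) => (p.length : WithBot ℕ∞)) L
  · refine Order.krullDim_le_of_strictMono
      (PrimeSpectrum.comap (algebraMap (R ⧸ RingHom.ker f) S)) ?_
    intro P Q hPQ
    obtain ⟨hle, x, hx⟩ := SetLike.lt_iff_le_and_exists.1 (show P.asIdeal < Q.asIdeal from hPQ)
    exact Ideal.comap_lt_comap_of_integral_mem_sdiff hle hx (hIntg x)

end dim

section poly
variable {K : Type} [Field K]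

lemma isIntegralElem_of_eq {R S : Type} [CommRing R] [CommRing S] [Nontrivial S]
    [Algebra K R] [Algebra K S]
    (φ : R →ₐ[K] S) (u : S) (N D : Polynomial K) (r : R) (hND : D.natDegree < N.natDegree)
    (h : Polynomial.aeval u N = φ r * Polynomial.aeval u D) :
    (φ : R →+* S).IsIntegralElem u := by
  have : Nontrivial R := φ.toRingHom.domain_nontrivial
  have hN : N ≠ 0 := by rintro rfl; simp at hND
  have hlc : N.leadingCoeff ≠ 0 := by simpa using hN
  set D' : Polynomial R := D.map (algebraMap K R)
  set N' : Polynomial R := N.map (algebraMap K R)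
  set c : R := algebraMap K R N.leadingCoeff⁻¹
  have hinj : Function.Injective (algebraMap K R) := (algebraMap K R).injective
  have hN'm : (Polynomial.C c * N').Monic := by
    rw [Polynomial.Monic, Polynomial.leadingCoeff, show Polynomial.C c * N' =
      (Polynomial.C N.leadingCoeff⁻¹ * N).map (algebraMap K R) by
        simp [N', c]]
    rw [Polynomial.natDegree_map_eq_of_injective hinj, Polynomial.coeff_map,
      ← Polynomial.leadingCoeff, mul_comm, Polynomial.monic_mul_leadingCoeff_inv hN, map_one]
  have hN'd : (Polynomial.C c * N').natDegree = N.natDegree := by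
    rw [show Polynomial.C c * N' =
      (Polynomial.C N.leadingCoeff⁻¹ * N).map (algebraMap K R) by
        simp [N', c], Polynomial.natDegree_map_eq_of_injective hinj,
        Polynomial.natDegree_C_mul (inv_ne_zero hlc)]
  refine ⟨Polynomial.C c * N' - Polynomial.C (c * r) * D', ?_, ?_⟩
  · refine hN'm.sub_of_left ?_
    refine Polynomial.degree_lt_degree ?_
    rw [hN'd]
    exact ((Polynomial.natDegree_C_mul_le _ _).trans Polynomial.natDegree_map_le).trans_lt hND
  · have e : ∀ F : Polynomial K, Polynomial.eval₂ (φ : R →+* S) u (F.map (algebraMap K R)) =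
        Polynomial.aeval u F := by
      intro F
      rw [Polynomial.eval₂_map, Polynomial.aeval_def]
      congr 1
      ext x; simp
    simp only [Polynomial.eval₂_sub, Polynomial.eval₂_mul, Polynomial.eval₂_C, D', N', e, h]
    simp; ring

lemma aeval_reflect {S : Type} [CommRing S] [Algebra K S] (u v : S) (huv : u * v = 1) (m : ℕ)
    (f : Polynomial K) (hf : f.natDegree ≤ m) :
    Polynomial.aeval u (Polynomial.reflect m f) = u ^ m * Polynomial.aeval v f := by
  let : Invertible v := ⟨u, huv, by rw [mul_comm]; exact huv⟩
  have := Polynomial.eval₂_reflect_mul_pow (algebraMap K S) v m f hf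
  rw [Polynomial.aeval_def, Polynomial.aeval_def, ← this]
  change _ = u ^ m * (Polynomial.eval₂ (algebraMap K S) u _ * v ^ m)
  rw [mul_comm, mul_assoc, ← mul_pow, mul_comm v u, huv]; simp

/-- The reflected translate of a polynomial. -/
noncomputable def refl (m : ℕ) (b : K) (f : Polynomial K) : Polynomial K :=
  Polynomial.reflect m (f.comp (Polynomial.X + Polynomial.C b))

lemma aeval_refl {S : Type} [CommRing S] [Algebra K S] (u t : S) (b : K)
    (huv : u * (t - algebraMap K S b) = 1) (m : ℕ)
    (f : Polynomial K) (hf : f.natDegree ≤ m) :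
    Polynomial.aeval u (refl m b f) = u ^ m * Polynomial.aeval t f := by
  rw [refl, aeval_reflect u _ huv]
  · simp [Polynomial.aeval_comp]
  · simpa [Polynomial.natDegree_comp] using hf

lemma coeff_refl (m : ℕ) (b : K) (f : Polynomial K) : (refl m b f).coeff m = f.eval b := by
  rw [refl, Polynomial.coeff_reflect, Polynomial.revAt_le le_rfl, Nat.sub_self,
    Polynomial.coeff_zero_eq_eval_zero]
  simp

lemma natDegree_refl_le (m : ℕ) (b : K) (f : Polynomial K) (hf : f.natDegree ≤ m) :
    (refl m b f).natDegree ≤ m := by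
  refine Polynomial.natDegree_reflect_le.trans ?_
  simpa [Polynomial.natDegree_comp] using hf

lemma natDegree_refl_eq (m : ℕ) (b : K) (f : Polynomial K) (hf : f.natDegree ≤ m)
    (h : f.eval b ≠ 0) : (refl m b f).natDegree = m := by
  refine le_antisymm (natDegree_refl_le m b f hf) (Polynomial.le_natDegree_of_ne_zero ?_)
  rwa [coeff_refl]

lemma natDegree_refl_lt (m : ℕ) (hm : 0 < m) (b : K) (f : Polynomial K) (hf : f.natDegree ≤ m)
    (h : f.eval b = 0) : (refl m b f).natDegree < m := by
  refine lt_of_le_of_ne (natDegree_refl_le m b f hf) fun e => ?_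
  have := coeff_refl m b f
  rw [h] at this
  rw [← e] at this
  have h0 : refl (refl m b f).natDegree b f = 0 := by
    rw [e] at this ⊢
    rwa [← Polynomial.leadingCoeff_eq_zero, Polynomial.leadingCoeff, e]
  rw [e] at h0
  rw [h0] at e
  simp at e; omega

lemma eval_zero_refl (m : ℕ) (b : K) (f : Polynomial K) (hf : f.natDegree = m) :
    (refl m b f).eval 0 = f.leadingCoeff := by
  rw [← Polynomial.coeff_zero_eq_eval_zero, refl, Polynomial.coeff_reflect,
    Polynomial.revAt_le (Nat.zero_le _), Nat.sub_zero]
  have : (f.comp (Polynomial.X + Polynomial.C b)).natDegree = m := by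
    simp [Polynomial.natDegree_comp, hf]
  rw [← this, ← Polynomial.leadingCoeff, Polynomial.leadingCoeff_comp (by simp)]
  simp

lemma wr_ne_zero [CharZero K] (A q : Polynomial K) (hq : q ≠ 0)
    (h : q.natDegree < A.natDegree) :
    Polynomial.derivative A * q - A * Polynomial.derivative q ≠ 0 := by
  intro h0
  have hA : A ≠ 0 := by rintro rfl; simp at h
  have hlA : A.leadingCoeff ≠ 0 := by simpa using hA
  have hlq : q.leadingCoeff ≠ 0 := by simpa using hq
  obtain ⟨d, hd⟩ : ∃ d, A.natDegree = d + 1 := ⟨A.natDegree - 1, by omega⟩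
  have h1 : (Polynomial.derivative A * q).coeff (d + q.natDegree) =
      (d + 1) * A.leadingCoeff * q.leadingCoeff := by
    rw [Polynomial.coeff_mul_add_eq_of_natDegree_le
      ((Polynomial.natDegree_derivative_le A).trans (by omega)) le_rfl, Polynomial.coeff_derivative,
      ← hd]
    simp only [Polynomial.leadingCoeff]; ring
  have h2 : (A * Polynomial.derivative q).coeff (d + q.natDegree) =
      q.natDegree * A.leadingCoeff * q.leadingCoeff := by
    rcases Nat.eq_zero_or_pos q.natDegree with e | e
    · rw [Polynomial.derivative_of_natDegree_zero e, e]; simp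
    · obtain ⟨k, hk⟩ : ∃ k, q.natDegree = k + 1 := ⟨q.natDegree - 1, by omega⟩
      rw [hk, show d + (k + 1) = (d + 1) + k by ring,
        Polynomial.coeff_mul_add_eq_of_natDegree_le hd.le
        ((Polynomial.natDegree_derivative_le q).trans (by omega)), Polynomial.coeff_derivative,
        ← hd, ← hk]
      simp only [Polynomial.leadingCoeff, hk]; push_cast; ring
  have h3 := congrArg (fun F => Polynomial.coeff F (d + q.natDegree)) h0
  simp only [Polynomial.coeff_sub, h1, h2, Polynomial.coeff_zero] at h3
  have h4 : ((d + 1 : K) - q.natDegree) * (A.leadingCoeff * q.leadingCoeff) = 0 := by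
    linear_combination h3
  rcases mul_eq_zero.1 h4 with h5 | h5
  · have : ((d + 1 : ℕ) : K) = (q.natDegree : K) := by push_cast; linear_combination h5
    have := Nat.cast_injective this
    omega
  · exact (mul_ne_zero hlA hlq) h5

end poly

end RatTB


open MvPolynomial

namespace RatTB

section ring
variable {K : Type} [Field K] {n : ℕ}

/-- The coordinate ring of the punctured line. -/
abbrev BB (q : Polynomial K) : Type := Localization.Away q

/-- inclusion of polynomials -/
noncomputable def io (q : Polynomial K) : Polynomial K →ₐ[K] BB q :=
  IsScalarTower.toAlgHom K (Polynomial K) (BB q)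

/-- inverse of `q` -/
noncomputable def iv (q : Polynomial K) : BB q := IsLocalization.Away.invSelf q

lemma io_mul_iv (q : Polynomial K) : io q q * iv q = 1 :=
  IsLocalization.Away.mul_invSelf (S := BB q) q

lemma exists_rep (q : Polynomial K) (x : BB q) : ∃ (f : Polynomial K) (k : ℕ),
    x = io q f * iv q ^ k := by
  obtain ⟨k, f, h⟩ := IsLocalization.Away.surj q x
  refine ⟨f, k, ?_⟩
  change x * io q q ^ k = io q f at h
  rw [← h, mul_assoc, ← mul_pow, io_mul_iv]; simp

/-- The universal property. -/
noncomputable def lft {S : Type} [CommRing S] [Algebra K S] (q : Polynomial K) (u : S)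
    (hu : IsUnit (Polynomial.aeval u q)) : BB q →+* S :=
  IsLocalization.Away.lift (S := BB q) (g := (Polynomial.aeval u : Polynomial K →ₐ[K] S).toRingHom)
    q hu

lemma lft_io {S : Type} [CommRing S] [Algebra K S] (q : Polynomial K) (u : S)
    (hu : IsUnit (Polynomial.aeval u q)) (f : Polynomial K) :
    lft q u hu (io q f) = Polynomial.aeval u f :=
  IsLocalization.Away.lift_eq (S := BB q) q hu f

lemma isUnit_ev (q : Polynomial K) (a : K) (ha : q.eval a ≠ 0) :
    IsUnit (Polynomial.aeval a q) := by
  rw [isUnit_iff_ne_zero]; simpa using ha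

/-- evaluation -/
noncomputable def ev (q : Polynomial K) (a : K) (ha : q.eval a ≠ 0) : BB q →+* K :=
  lft q a (isUnit_ev q a ha)

lemma ev_io (q : Polynomial K) (a : K) (ha : q.eval a ≠ 0) (f : Polynomial K) :
    ev q a ha (io q f) = f.eval a := by
  rw [ev, lft_io]; simp

lemma ev_iv (q : Polynomial K) (a : K) (ha : q.eval a ≠ 0) :
    ev q a ha (iv q) = (q.eval a)⁻¹ := by
  have := congrArg (ev q a ha) (io_mul_iv q)
  rw [map_mul, ev_io, map_one] at this
  exact eq_inv_of_mul_eq_one_right this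

lemma eq_zero_of_ev (q : Polynomial K) (x : BB q) (V : Set K) (hV : V.Infinite)
    (hVq : ∀ a ∈ V, q.eval a ≠ 0) (h : ∀ a (ha : a ∈ V), ev q a (hVq a ha) x = 0) : x = 0 := by
  obtain ⟨f, k, rfl⟩ := exists_rep q x
  have : f = 0 := by
    refine Polynomial.eq_zero_of_infinite_isRoot f (hV.mono fun a ha => ?_)
    have := h a ha
    rw [map_mul, map_pow, ev_io, ev_iv] at this
    rcases mul_eq_zero.1 this with h1 | h1
    · exact h1
    · exact absurd h1 (pow_ne_zero _ (inv_ne_zero (hVq a ha)))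
  simp [this]

/-- The parametrisation -/
noncomputable def PP (p : Fin n → Polynomial K) (q : Polynomial K) (t : K) : Fin n → K :=
  fun i => (p i).eval t / q.eval t

/-- The comorphism of the parametrisation -/
noncomputable def ph (p : Fin n → Polynomial K) (q : Polynomial K) :
    MvPolynomial (Fin n) K →ₐ[K] BB q :=
  aeval fun i => io q (p i) * iv q

lemma ev_ph (p : Fin n → Polynomial K) (q : Polynomial K) (a : K) (ha : q.eval a ≠ 0)
    (f : MvPolynomial (Fin n) K) : ev q a ha (ph p q f) = aeval (PP p q a) f := by
  induction f using MvPolynomial.induction_on with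
  | C c =>
    have : ph p q (C c) = io q (Polynomial.C c) := by
      rw [ph, aeval_C]; exact ((io q).commutes c).symm
    rw [this, ev_io]; simp
  | add f g hf hg => simp [hf, hg]
  | mul_X f i hf =>
    rw [map_mul, map_mul, hf, map_mul]
    congr 1
    simp [ph, ev_io, ev_iv, PP, div_eq_mul_inv]

lemma ph_eq_zero_iff (p : Fin n → Polynomial K) (q : Polynomial K) (V : Set K) (hV : V.Infinite)
    (hVq : ∀ a ∈ V, q.eval a ≠ 0) (f : MvPolynomial (Fin n) K) :
    ph p q f = 0 ↔ ∀ t ∈ V, aeval (PP p q t) f = 0 := by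
  constructor
  · intro h t ht
    rw [← ev_ph p q t (hVq t ht), h, map_zero]
  · intro h
    refine eq_zero_of_ev q _ V hV hVq fun a ha => ?_
    rw [ev_ph, h a ha]

/-- A parametrisation in normal form. -/
structure Good (C : Set (Fin n → K)) (p : Fin n → Polynomial K) (q : Polynomial K) (V : Set K)
    (i0 : Fin n) : Prop where
  q_ne : q ≠ 0
  nocommon : ∀ a, q.eval a = 0 → ∃ i, (p i).eval a ≠ 0
  cofin : Vᶜ.Finite
  V_sub : ∀ a ∈ V, q.eval a ≠ 0
  inj : Set.InjOn (PP p q) V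
  ideal : ∀ f, f ∈ vanishingIdeal K C ↔ ∀ t ∈ V, aeval (PP p q t) f = 0
  closed : ∀ x, (∀ f ∈ vanishingIdeal K C, aeval x f = 0) → x ∈ C
  deg_lt : q.natDegree < (p i0).natDegree
  deg_le : ∀ i, (p i).natDegree ≤ (p i0).natDegree

variable {C : Set (Fin n → K)} {p : Fin n → Polynomial K} {q : Polynomial K} {V : Set K}
  {i0 : Fin n}

lemma integralElem_pow {R S : Type} [CommRing R] [CommRing S] {f : R →+* S} {x : S}
    (h : f.IsIntegralElem x) (k : ℕ) : f.IsIntegralElem (x ^ k) := by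
  induction k with
  | zero => rw [pow_zero]; exact RingHom.isIntegralElem_one _
  | succ k ih => rw [pow_succ]; exact ih.mul _ h

lemma BB_nontrivial (hq : q ≠ 0) : Nontrivial (BB q) := by
  refine ⟨⟨0, 1, fun h => hq ?_⟩⟩
  have hdom := IsLocalization.injective (BB q) (M := Submonoid.powers q)
    (powers_le_nonZeroDivisors_of_noZeroDivisors hq)
  have : io q q = io q 0 := by
    rw [← mul_one (io q q), ← h]; simp
  exact hdom this

lemma Good.isIntegral [IsAlgClosed K] (G : Good C p q V i0) :
    (ph p q : MvPolynomial (Fin n) K →+* BB q).IsIntegral := by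
  have := BB_nontrivial G.q_ne
  have hx : ∀ i, ph p q (X i) = io q (p i) * iv q := by intro i; simp [ph]
  have hae : ∀ f : Polynomial K, Polynomial.aeval (io q Polynomial.X) f = io q f := by
    intro f
    have := Polynomial.aeval_algHom_apply (io q) Polynomial.X f
    rw [this]; simp
  have hrel : ∀ i, io q (p i) = ph p q (X i) * io q q := by
    intro i
    rw [hx, mul_assoc, mul_comm (iv q), io_mul_iv, mul_one]
  have ht : (ph p q : MvPolynomial (Fin n) K →+* BB q).IsIntegralElem (io q Polynomial.X) := by
    refine isIntegralElem_of_eq (ph p q) _ (p i0) q (X i0) G.deg_lt ?_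
    rw [hae, hae, hrel]
  have hu : ∀ b, q.eval b = 0 → ∃ u : BB q,
      u * (io q (Polynomial.X - Polynomial.C b)) = 1 ∧
      (ph p q : MvPolynomial (Fin n) K →+* BB q).IsIntegralElem u := by
    intro b hb
    obtain ⟨j, hj⟩ := G.nocommon b hb
    obtain ⟨q', hq'⟩ := Polynomial.dvd_iff_isRoot.2 hb
    have hu : (iv q * io q q') * (io q (Polynomial.X - Polynomial.C b)) = 1 := by
      rw [mul_assoc, ← map_mul, mul_comm q', ← hq', mul_comm, io_mul_iv]
    refine ⟨_, hu, ?_⟩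
    set m := max (p j).natDegree q.natDegree
    have hm : 0 < m := by
      refine lt_of_lt_of_le ?_ (le_max_right _ _)
      rw [Polynomial.natDegree_pos_iff_degree_pos]
      exact Polynomial.degree_pos_of_root G.q_ne hb
    have hu' : (iv q * io q q') * (io q Polynomial.X - algebraMap K (BB q) b) = 1 := by
      rw [← hu, map_sub]; congr 2
    refine isIntegralElem_of_eq (ph p q) _ (refl m b (p j)) (refl m b q) (X j) ?_ ?_
    · rw [natDegree_refl_eq m b (p j) (le_max_left _ _) hj]
      exact natDegree_refl_lt m hm b q (le_max_right _ _) hb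
    · rw [aeval_refl _ _ b hu' m _ (le_max_left _ _), aeval_refl _ _ b hu' m _ (le_max_right _ _),
        hae, hae, hrel]
      ring
  have hC : ∀ c : K, (ph p q : MvPolynomial (Fin n) K →+* BB q).IsIntegralElem
      (io q (Polynomial.C c)) := by
    intro c
    have : io q (Polynomial.C c) =
        (ph p q : MvPolynomial (Fin n) K →+* BB q) (MvPolynomial.C c) := by
      simp only [ph, RingHom.coe_coe, aeval_C]
      exact (io q).commutes c
    rw [this]
    exact RingHom.isIntegralElem_map _
  have hpoly : ∀ f : Polynomial K, (ph p q : MvPolynomial (Fin n) K →+* BB q).IsIntegralElem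
      (io q f) := by
    intro f
    induction f using Polynomial.induction_on' with
    | add f g hf hg => rw [map_add]; exact hf.add _ hg
    | monomial k c =>
      rw [← Polynomial.C_mul_X_pow_eq_monomial, map_mul, map_pow]
      exact (hC c).mul _ (integralElem_pow ht k)
  have hiv : (ph p q : MvPolynomial (Fin n) K →+* BB q).IsIntegralElem (iv q) := by
    have key : ∀ s : Multiset K, (∀ b ∈ s, q.eval b = 0) → ∃ u : BB q,
        u * io q (s.map fun b => Polynomial.X - Polynomial.C b).prod = 1 ∧
        (ph p q : MvPolynomial (Fin n) K →+* BB q).IsIntegralElem u := by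
      intro s
      induction s using Multiset.induction_on with
      | empty => intro _; exact ⟨1, by simp, RingHom.isIntegralElem_one _⟩
      | cons b s ih =>
        intro h
        obtain ⟨u, hu1, hu2⟩ := ih fun c hc => h c (Multiset.mem_cons_of_mem hc)
        obtain ⟨v, hv1, hv2⟩ := hu b (h b (Multiset.mem_cons_self _ _))
        refine ⟨v * u, ?_, hv2.mul _ hu2⟩
        rw [Multiset.map_cons, Multiset.prod_cons, map_mul]
        calc _ = (v * io q (Polynomial.X - Polynomial.C b)) * (u * io q (s.map fun b =>
              Polynomial.X - Polynomial.C b).prod) := by ring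
          _ = 1 := by rw [hu1, hv1, one_mul]
    obtain ⟨u, hu1, hu2⟩ := key q.roots fun b hb => (Polynomial.mem_roots G.q_ne).1 hb
    have hfac := (IsAlgClosed.splits q).eq_prod_roots
    have hlc : q.leadingCoeff ≠ 0 := by simpa using G.q_ne
    have e : iv q = io q (Polynomial.C q.leadingCoeff⁻¹) * u := by
      have h1 : io q (Polynomial.C q.leadingCoeff⁻¹) * u * io q q = 1 := by
        have h3 := congrArg (io q) hfac
        rw [map_mul] at h3
        rw [h3]
        have h2 : io q (Polynomial.C q.leadingCoeff⁻¹) * io q (Polynomial.C q.leadingCoeff) = 1 := by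
          rw [← map_mul, ← Polynomial.C_mul, inv_mul_cancel₀ hlc]; simp
        calc _ = (io q (Polynomial.C q.leadingCoeff⁻¹) * io q (Polynomial.C q.leadingCoeff)) *
              (u * io q (q.roots.map fun b => Polynomial.X - Polynomial.C b).prod) := by ring
          _ = 1 := by rw [h2, hu1, one_mul]
      calc iv q = (io q (Polynomial.C q.leadingCoeff⁻¹) * u * io q q) * iv q := by
            rw [h1, one_mul]
        _ = (io q (Polynomial.C q.leadingCoeff⁻¹) * u) * (io q q * iv q) := by ring
        _ = _ := by rw [io_mul_iv, mul_one]
    rw [e]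
    exact (hC _).mul _ hu2
  intro x
  obtain ⟨f, k, rfl⟩ := exists_rep q x
  exact (hpoly f).mul _ (integralElem_pow hiv k)

lemma Good.infinite [Infinite K] (G : Good C p q V i0) : V.Infinite := by
  have := G.cofin.infinite_compl
  rwa [compl_compl] at this

lemma Good.ker [Infinite K] (G : Good C p q V i0) :
    RingHom.ker (ph p q : MvPolynomial (Fin n) K →+* BB q) = vanishingIdeal K C := by
  ext f
  rw [RingHom.mem_ker, G.ideal]
  exact ph_eq_zero_iff p q V G.infinite G.V_sub f

lemma exists_common_root [IsAlgClosed K] {ι : Type} (F : ι → Polynomial K)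
    (h : Ideal.span (Set.range F) ≠ ⊤) : ∃ a, ∀ i, (F i).eval a = 0 := by
  obtain ⟨M, hM, hle⟩ := Ideal.exists_le_maximal _ h
  have hP : M.IsPrincipal := inferInstance
  obtain ⟨f, hf⟩ := hP
  have hdeg : f.degree ≠ 0 := by
    intro h0
    apply hM.ne_top
    rw [hf]
    exact Ideal.span_singleton_eq_top.2 (Polynomial.isUnit_iff_degree_eq_zero.2 h0)
  obtain ⟨a, ha⟩ := IsAlgClosed.exists_root f hdeg
  refine ⟨a, fun i => ?_⟩
  have : F i ∈ M := hle (Ideal.subset_span ⟨i, rfl⟩)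
  rw [hf] at this
  obtain ⟨g, hg⟩ := Ideal.mem_span_singleton.1 this
  rw [hg, Polynomial.eval_mul, ha, zero_mul]

lemma Good.mem [Infinite K] (G : Good C p q V i0) (a : K) (ha : q.eval a ≠ 0) : PP p q a ∈ C := by
  refine G.closed _ fun f hf => ?_
  rw [← G.ker] at hf
  rw [← ev_ph p q a ha, show ph p q f = 0 from hf, map_zero]

lemma Good.surj [IsAlgClosed K] (G : Good C p q V i0) (x : Fin n → K) (hx : x ∈ C) :
    ∃ a, q.eval a ≠ 0 ∧ x = PP p q a := by
  have hInf : Infinite K := IsAlgClosed.instInfinite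
  by_contra! hno
  have htop : Ideal.span (Set.range fun i => p i - Polynomial.C (x i) * q) = ⊤ := by
    by_contra h
    obtain ⟨a, ha⟩ := exists_common_root _ h
    have ha' : ∀ i, (p i).eval a = x i * q.eval a := by
      intro i; have := ha i
      simp at this; linear_combination this
    have hq : q.eval a ≠ 0 := by
      intro h0
      obtain ⟨j, hj⟩ := G.nocommon a h0
      rw [ha', h0, mul_zero] at hj; exact hj rfl
    refine hno a hq ?_
    funext i
    rw [PP, ha', mul_div_cancel_right₀ _ hq]
  set M : Ideal (MvPolynomial (Fin n) K) := vanishingIdeal K {x}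
  have hker : RingHom.ker (ph p q : MvPolynomial (Fin n) K →+* BB q) ≤ M := by
    rw [G.ker]
    exact vanishingIdeal_anti_mono (by simpa using hx)
  have hMtop : M.map (ph p q : MvPolynomial (Fin n) K →+* BB q) = ⊤ := by
    have h1 : (Ideal.span (Set.range fun i => p i - Polynomial.C (x i) * q)).map
        (io q : Polynomial K →+* BB q) = ⊤ := by
      rw [htop, Ideal.map_top]
    rw [← top_le_iff, ← h1, Ideal.map_span, Ideal.span_le]
    rintro _ ⟨_, ⟨i, rfl⟩, rfl⟩
    have hm : (X i - MvPolynomial.C (x i) : MvPolynomial (Fin n) K) ∈ M := by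
      simp [M]
    have := Ideal.mul_mem_right (io q q) _
      (Ideal.mem_map_of_mem (ph p q : MvPolynomial (Fin n) K →+* BB q) hm)
    convert this using 1
    have hc : ph p q (MvPolynomial.C (x i)) = io q (Polynomial.C (x i)) := by
      rw [ph, aeval_C]; exact ((io q).commutes _).symm
    have hX : ph p q (X i) = io q (p i) * iv q := by simp [ph]
    simp only [RingHom.coe_coe, map_sub, map_mul, hc, hX]
    rw [sub_mul, mul_assoc, mul_comm (iv q), io_mul_iv, mul_one]
    exact Iff.rfl
  rw [Ideal.map_eq_top_iff_of_ker_le _ hker G.isIntegral] at hMtop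
  exact (inferInstance : (vanishingIdeal K {x}).IsMaximal).ne_top hMtop

end ring
end RatTB


open MvPolynomial

namespace RatTB

section gcdstuff
variable {K : Type} [Field K]

lemma exists_gcd_factor {ι : Type} [Fintype ι] (F : ι → Polynomial K) (i : ι) (hi : F i ≠ 0) :
    ∃ (G : Polynomial K) (F' : ι → Polynomial K), G ≠ 0 ∧ (∀ j, F j = G * F' j) ∧
      ∀ a, ∃ j, (F' j).eval a ≠ 0 := by
  classical
  let _ : NormalizationMonoid (Polynomial K) := inferInstance
  let _ : NormalizedGCDMonoid (Polynomial K) := Classical.choice inferInstance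
  obtain ⟨F', h1, h2⟩ := Finset.extract_gcd (s := Finset.univ) F ⟨i, Finset.mem_univ _⟩
  refine ⟨_, F', ?_, fun j => h1 j (Finset.mem_univ _), fun a => ?_⟩
  · intro h0
    apply hi
    rw [h1 i (Finset.mem_univ _), h0, zero_mul]
  · by_contra! h
    have : (Polynomial.X - Polynomial.C a) ∣ Finset.univ.gcd F' :=
      Finset.dvd_gcd fun j _ => Polynomial.dvd_iff_isRoot.2 (h j)
    rw [h2] at this
    exact Polynomial.not_isUnit_X_sub_C a (isUnit_of_dvd_one this)

end gcdstuff

section good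
variable {K : Type} [Field K] [IsAlgClosed K] {n : ℕ}

lemma vanishing_zclosure (W : Set (Fin n → K)) (f : MvPolynomial (Fin n) K) :
    f ∈ vanishingIdeal K (zclosure W) ↔ ∀ x ∈ W, aeval x f = 0 := by
  constructor
  · intro h x hx
    exact h x (zeroLocus_vanishingIdeal_le W hx)
  · intro h x hx
    exact hx f h

lemma exists_good (C : Set (Fin n → K))
    (g h : Fin n → Polynomial K) (hh : ∀ i, h i ≠ 0)
    (hdom : C = zclosure ((fun t => fun i => (g i).eval t / (h i).eval t) ''
      {t | ∀ i, (h i).eval t ≠ 0}))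
    (U : Set K) (hUopen : Uᶜ.Finite)
    (hUD : U ⊆ {t | ∀ i, (h i).eval t ≠ 0})
    (hP1 : Set.InjOn (fun t => fun i => (g i).eval t / (h i).eval t) U) :
    ∃ p q V i0, Good C p q V i0 := by
  classical
  have hInf : Infinite K := IsAlgClosed.instInfinite
  have hUinf : U.Infinite := by
    have := hUopen.infinite_compl
    rwa [compl_compl] at this
  set q0 : Polynomial K := ∏ j, h j with hq0
  set F : Option (Fin n) → Polynomial K := fun o =>
    match o with
    | none => q0
    | some i => g i * ∏ j ∈ Finset.univ.erase i, h j with hF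
  have hq0ne : F none ≠ 0 := Finset.prod_ne_zero_iff.2 fun j _ => hh j
  obtain ⟨G, F', hG, hFG, hcop⟩ := exists_gcd_factor F none hq0ne
  set q := F' none with hq
  set p : Fin n → Polynomial K := fun i => F' (some i) with hp
  have hqne : q ≠ 0 := by
    intro h0; apply hq0ne; rw [hFG none, ← hq, h0, mul_zero]
  have hnc : ∀ a, q.eval a = 0 → ∃ i, (p i).eval a ≠ 0 := by
    intro a ha
    obtain ⟨o, ho⟩ := hcop a
    cases o with
    | none => exact absurd ha ho
    | some i => exact ⟨i, ho⟩
  have hDq : ∀ t, (∀ i, (h i).eval t ≠ 0) → q.eval t ≠ 0 := by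
    intro t ht h0
    have h1 : (F none).eval t = 0 := by
      rw [hFG none, Polynomial.eval_mul, ← hq, h0, mul_zero]
    have h2 : (F none).eval t = ∏ j, (h j).eval t := by
      simp only [hF, hq0, Polynomial.eval_prod]
    rw [h2] at h1
    exact Finset.prod_ne_zero_iff.2 (fun j _ => ht j) h1
  have hPP : ∀ t, (∀ i, (h i).eval t ≠ 0) →
      (fun i => (g i).eval t / (h i).eval t) = PP p q t := by
    intro t ht
    funext i
    have hqt := hDq t ht
    rw [PP, div_eq_div_iff (ht i) hqt]
    have hrel : g i * q = p i * h i := by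
      apply mul_left_cancel₀ hG
      have h1 : G * q = h i * ∏ j ∈ Finset.univ.erase i, h j := by
        rw [hq, ← hFG none, Finset.mul_prod_erase _ _ (Finset.mem_univ i)]
      have h2 : G * p i = g i * ∏ j ∈ Finset.univ.erase i, h j := by
        simp only [hp]; rw [← hFG (some i)]
      calc G * (g i * q) = g i * (G * q) := by ring
        _ = (G * p i) * h i := by rw [h1, h2]; ring
        _ = _ := by ring
    have := congrArg (Polynomial.eval t) hrel
    simpa using this
  have hDfin : {t | ∀ i, (h i).eval t ≠ 0}.Infinite := hUinf.mono hUD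
  have hUq : ∀ a ∈ U, q.eval a ≠ 0 := fun a ha => hDq a (hUD ha)
  have hinj : Set.InjOn (PP p q) U := by
    intro a ha b hb hab
    apply hP1 ha hb
    simp only
    rw [hPP a (hUD ha), hPP b (hUD hb), hab]
  have hideal : ∀ f, f ∈ vanishingIdeal K C ↔ ∀ t ∈ U, aeval (PP p q t) f = 0 := by
    intro f
    rw [hdom, vanishing_zclosure, ← ph_eq_zero_iff p q U hUinf hUq,
      ph_eq_zero_iff p q _ hDfin (fun a ha => hDq a ha)]
    constructor
    · intro H t ht
      rw [← hPP t ht]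
      exact H _ ⟨t, ht, rfl⟩
    · rintro H _ ⟨t, ht, rfl⟩
      simp only
      rw [hPP t ht]
      exact H t ht
  have hclosed : ∀ x, (∀ f ∈ vanishingIdeal K C, aeval x f = 0) → x ∈ C := by
    intro x hx
    rw [hdom]
    intro f hf
    apply hx
    rw [hdom, vanishing_zclosure]
    exact hf
  by_cases hcase : ∃ i, q.natDegree < (p i).natDegree
  · obtain ⟨i, hi⟩ := hcase
    obtain ⟨i0, -, hi0⟩ := Finset.exists_max_image Finset.univ (fun i => (p i).natDegree)
      ⟨i, Finset.mem_univ _⟩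
    exact ⟨p, q, U, i0, hqne, hnc, hUopen, hUq, hinj, hideal, hclosed,
      hi.trans_le (hi0 i (Finset.mem_univ _)), fun j => hi0 j (Finset.mem_univ _)⟩
  · push Not at hcase
    set m := q.natDegree with hm
    have hmpos : 0 < m := by
      by_contra h0
      have h0 : m = 0 := by omega
      obtain ⟨a, ha, b, hb, hab⟩ := hUinf.nontrivial
      apply hab
      apply hinj ha hb
      funext i
      have h1 := Polynomial.eq_C_of_natDegree_eq_zero (h0 ▸ hm.symm : q.natDegree = 0)
      have h2 := Polynomial.eq_C_of_natDegree_eq_zero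
        (Nat.le_zero.1 (h0 ▸ hcase i) : (p i).natDegree = 0)
      rw [PP, PP, h1, h2]; simp
    obtain ⟨b, hb⟩ := IsAlgClosed.exists_root q
      (Polynomial.natDegree_pos_iff_degree_pos.1 hmpos).ne'
    obtain ⟨j, hj⟩ := hnc b hb
    have hev : ∀ u : K, u ≠ 0 → ∀ f : Polynomial K, f.natDegree ≤ m →
        (refl m b f).eval u = u ^ m * f.eval (b + u⁻¹) := by
      intro u hu f hf
      have := aeval_refl (S := K) u (b + u⁻¹) b (by simp [hu]) m f hf
      simpa using this
    have hPPu : ∀ u : K, u ≠ 0 → PP (fun i => refl m b (p i)) (refl m b q) u =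
        PP p q (b + u⁻¹) := by
      intro u hu
      funext i
      simp only [PP]
      rw [hev u hu _ (hcase i), hev u hu _ hm.symm.le, mul_div_mul_left _ _ (pow_ne_zero _ hu)]
    have hz : (refl m b q).eval 0 ≠ 0 := by
      rw [eval_zero_refl m b q hm.symm]; simpa using hqne
    set V : Set K := {u | u ≠ 0 ∧ b + u⁻¹ ∈ U} with hV
    have hVc : Vᶜ.Finite := by
      have : Vᶜ ⊆ {0} ∪ (fun t => (t - b)⁻¹) '' Uᶜ := by
        intro u hu
        by_cases h0 : u = 0
        · left; exact h0
        · right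
          refine ⟨b + u⁻¹, fun h1 => hu ⟨h0, h1⟩, by simp⟩
      exact ((Set.finite_singleton _).union (hUopen.image _)).subset this
    have hVinf : V.Infinite := by
      have := hVc.infinite_compl
      rwa [compl_compl] at this
    refine ⟨fun i => refl m b (p i), refl m b q, V, j, ?_, ?_, hVc, ?_, ?_, ?_, hclosed, ?_, ?_⟩
    · rintro h0; rw [h0] at hz; simp at hz
    · intro a ha
      have ha0 : a ≠ 0 := by rintro rfl; exact hz ha
      rw [hev a ha0 _ hm.symm.le] at ha
      obtain ⟨i, hi⟩ := hnc _ ((mul_eq_zero.1 ha).resolve_left (pow_ne_zero _ ha0))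
      refine ⟨i, ?_⟩
      rw [hev a ha0 _ (hcase i)]
      exact mul_ne_zero (pow_ne_zero _ ha0) hi
    · rintro a ⟨ha0, ha⟩
      rw [hev a ha0 _ hm.symm.le]
      exact mul_ne_zero (pow_ne_zero _ ha0) (hUq _ ha)
    · rintro u ⟨hu0, hu⟩ v ⟨hv0, hv⟩ huv
      rw [hPPu u hu0, hPPu v hv0] at huv
      have := hinj hu hv huv
      simpa using this
    · intro f
      have hWinf : (U \ {b}).Infinite := hUinf.sdiff (Set.finite_singleton b)
      rw [hideal, ← ph_eq_zero_iff p q U hUinf hUq,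
        ph_eq_zero_iff p q _ hWinf (fun a ha => hUq a ha.1)]
      constructor
      · rintro H u ⟨hu0, hu⟩
        rw [hPPu u hu0]
        exact H _ ⟨hu, by simpa using hu0⟩
      · rintro H t ⟨ht, htb⟩
        have htb' : t - b ≠ 0 := sub_ne_zero.2 htb
        have := H (t - b)⁻¹ ⟨inv_ne_zero htb', by simpa using ht⟩
        rw [hPPu _ (inv_ne_zero htb')] at this
        simpa using this
    · rw [natDegree_refl_eq m b (p j) (hcase j) hj]
      exact natDegree_refl_lt m hmpos b q hm.symm.le hb
    · intro i
      rw [natDegree_refl_eq m b (p j) (hcase j) hj]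
      exact natDegree_refl_le m b (p i) (hcase i)

end good

section tangent
variable {K : Type} [Field K] {n : ℕ}

lemma snd_eq (χ : MvPolynomial (Fin n) K →ₐ[K] DualNumber K) (f : MvPolynomial (Fin n) K) :
    TrivSqZeroExt.fst (χ f) = aeval (fun i => TrivSqZeroExt.fst (χ (X i))) f ∧
    TrivSqZeroExt.snd (χ f) = ∑ i, eval (fun i => TrivSqZeroExt.fst (χ (X i))) (pderiv i f) *
      TrivSqZeroExt.snd (χ (X i)) := by
  induction f using MvPolynomial.induction_on with
  | C c =>
    have : χ (C c) = algebraMap K (DualNumber K) c := χ.commutes c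
    rw [this]
    constructor
    · simp [TrivSqZeroExt.algebraMap_eq_inl]
    · simp [TrivSqZeroExt.algebraMap_eq_inl]
  | add f g hf hg =>
    simp only [map_add, TrivSqZeroExt.fst_add, TrivSqZeroExt.snd_add, hf.1, hg.1, hf.2, hg.2,
      add_mul, Finset.sum_add_distrib, and_self]
  | mul_X f j hf =>
    constructor
    · rw [map_mul, TrivSqZeroExt.fst_mul, hf.1]; simp
    · rw [map_mul, TrivSqZeroExt.snd_mul, hf.1, hf.2]
      simp only [Derivation.leibniz, smul_eq_mul, map_add, map_mul, eval_X, add_mul,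
        Finset.sum_add_distrib, pderiv_X, MulOpposite.smul_eq_mul_unop, MulOpposite.unop_op]
      congr 1
      · rw [Finset.sum_eq_single j]
        · simp [aeval_eq_eval]
        · intro i _ hij
          simp [Pi.single_apply, hij]
          try tauto
        · simp
      · rw [Finset.sum_mul]
        refine Finset.sum_congr rfl fun i _ => by ring

end tangent
end RatTB


open MvPolynomial

namespace RatTB

section tangent
variable {K : Type} [Field K] [IsAlgClosed K] {n : ℕ}
variable {C : Set (Fin n → K)} {p : Fin n → Polynomial K} {q : Polynomial K} {V : Set K}
  {i0 : Fin n}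

lemma aeval_dual (a : K) (f : Polynomial K) :
    Polynomial.aeval (TrivSqZeroExt.inl a + DualNumber.eps : DualNumber K) f =
      TrivSqZeroExt.inl (f.eval a) + TrivSqZeroExt.inr (f.derivative.eval a) := by
  have h := Polynomial.aeval_add_of_sq_eq_zero f (TrivSqZeroExt.inl a : DualNumber K)
    DualNumber.eps (by rw [pow_two]; exact DualNumber.eps_mul_eps)
  rw [h]
  have e : ∀ g : Polynomial K, Polynomial.aeval (TrivSqZeroExt.inl a : DualNumber K) g =
      TrivSqZeroExt.inl (g.eval a) := by
    intro g
    have := Polynomial.aeval_algebraMap_apply (DualNumber K) a g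
    simpa [TrivSqZeroExt.algebraMap_eq_inl] using this
  rw [e, e]
  congr 1
  rw [DualNumber.eps, TrivSqZeroExt.inl_mul_inr, smul_eq_mul, mul_one]

lemma Good.tangent (G : Good C p q V i0) (f : MvPolynomial (Fin n) K)
    (hf : f ∈ vanishingIdeal K C) (a : K) (ha : q.eval a ≠ 0) :
    ∑ i, eval (PP p q a) (pderiv i f) *
      (Polynomial.derivative (p i) * q - p i * Polynomial.derivative q).eval a = 0 := by
  have hInf : Infinite K := IsAlgClosed.instInfinite
  set u : DualNumber K := TrivSqZeroExt.inl a + DualNumber.eps with hu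
  have hunit : IsUnit (Polynomial.aeval u q) := by
    rw [TrivSqZeroExt.isUnit_iff_isUnit_fst, hu, aeval_dual]
    simpa using ha
  let χ : MvPolynomial (Fin n) K →ₐ[K] DualNumber K :=
    { (lft q u hunit).comp (ph p q : MvPolynomial (Fin n) K →+* BB q) with
      commutes' := by
        intro c
        have h1 : ph p q (MvPolynomial.C c) = io q (Polynomial.C c) := by
          rw [ph, aeval_C]; exact ((io q).commutes c).symm
        change lft q u hunit (ph p q (MvPolynomial.C c)) = _
        rw [h1, lft_io]; simp }
  have hχ : ∀ g, χ g = lft q u hunit (ph p q g) := fun g => rfl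
  have hX : ∀ i, χ (X i) * Polynomial.aeval u q = Polynomial.aeval u (p i) := by
    intro i
    rw [hχ, ← lft_io q u hunit, ← lft_io q u hunit, ← map_mul]
    congr 1
    simp only [ph, aeval_X]
    rw [mul_assoc, mul_comm (iv q), io_mul_iv, mul_one]
  have h1 : ∀ i, TrivSqZeroExt.fst (χ (X i)) * q.eval a = (p i).eval a := by
    intro i
    have := congrArg TrivSqZeroExt.fst (hX i)
    rw [hu, aeval_dual, aeval_dual] at this
    simpa using this
  have h2 : ∀ i, TrivSqZeroExt.fst (χ (X i)) * q.derivative.eval a +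
      TrivSqZeroExt.snd (χ (X i)) * q.eval a = (p i).derivative.eval a := by
    intro i
    have := congrArg TrivSqZeroExt.snd (hX i)
    rw [hu, aeval_dual, aeval_dual, TrivSqZeroExt.snd_mul] at this
    simpa [mul_comm] using this
  have hfst : (fun i => TrivSqZeroExt.fst (χ (X i))) = PP p q a := by
    funext i
    rw [PP, ← h1 i, mul_div_cancel_right₀ _ ha]
  have hker : ph p q f = 0 := by rw [← G.ker] at hf; exact hf
  have h3 := (snd_eq χ f).2
  rw [hχ f, hker, map_zero, hfst] at h3
  have h4 : ∀ i, (Polynomial.derivative (p i) * q - p i * Polynomial.derivative q).eval a =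
      TrivSqZeroExt.snd (χ (X i)) * (q.eval a * q.eval a) := by
    intro i
    simp only [Polynomial.eval_sub, Polynomial.eval_mul]
    rw [← h2 i, ← h1 i]; ring
  simp only [h4]
  rw [show (0 : K) = TrivSqZeroExt.snd (0 : DualNumber K) * (q.eval a * q.eval a) by simp, h3,
    Finset.sum_mul]
  exact Finset.sum_congr rfl fun i _ => by ring

lemma Good.exists_w [CharZero K] (G : Good C p q V i0) : ∃ w : Fin n → Polynomial K,
    (∀ i, (w i).natDegree ≤ 2 * (p i0).natDegree - 2) ∧ (∀ a, ∃ i, (w i).eval a ≠ 0) ∧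
    ∀ a, q.eval a ≠ 0 → (fun i => (w i).eval a) ∈ tangentSpaceAt C (PP p q a) := by
  have hInf : Infinite K := IsAlgClosed.instInfinite
  set W : Fin n → Polynomial K := fun i =>
    Polynomial.derivative (p i) * q - p i * Polynomial.derivative q with hW
  obtain ⟨D, w, hD, hDw, hw⟩ := exists_gcd_factor W i0 (wr_ne_zero _ _ G.q_ne G.deg_lt)
  refine ⟨w, fun i => ?_, hw, ?_⟩
  · by_cases h0 : w i = 0
    · simp [h0]
    have hWi : W i ≠ 0 := by rw [hDw]; exact mul_ne_zero hD h0
    have h1 : (w i).natDegree ≤ (W i).natDegree := by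
      rw [hDw i, Polynomial.natDegree_mul hD h0]; omega
    have h2 : W i = Polynomial.wronskian q (p i) := by
      rw [hW, Polynomial.wronskian]; ring
    have h3 := Polynomial.natDegree_wronskian_lt_add (h2 ▸ hWi)
    rw [← h2] at h3
    have := G.deg_lt; have := G.deg_le i
    omega
  · intro a ha f hf
    set x : BB q := ∑ i, ph p q (pderiv i f) * io q (w i) with hx
    have hev : ∀ b (hb : q.eval b ≠ 0), ev q b hb x =
        ∑ i, eval (PP p q b) (pderiv i f) * (w i).eval b := by
      intro b hb
      rw [hx, map_sum]
      refine Finset.sum_congr rfl fun i _ => ?_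
      rw [map_mul, ev_ph, ev_io, aeval_eq_eval]
    have hfin : (V \ {b | D.eval b = 0}).Infinite := G.infinite.sdiff (by
      have := Polynomial.finite_setOfPred_isRoot hD
      exact this)
    have hx0 : x = 0 := by
      refine eq_zero_of_ev q x _ hfin (fun b hb => G.V_sub b hb.1) ?_
      intro b hb
      rw [hev]
      have h1 := G.tangent f hf b (G.V_sub b hb.1)
      have h2 : D.eval b * ∑ i, eval (PP p q b) (pderiv i f) * (w i).eval b = 0 := by
        rw [← h1, Finset.mul_sum]
        refine Finset.sum_congr rfl fun i _ => ?_
        have : (W i).eval b = D.eval b * (w i).eval b := by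
          rw [hDw i, Polynomial.eval_mul]
        change _ = _ * (W i).eval b
        rw [this]; ring
      exact (mul_eq_zero.1 h2).resolve_left hb.2
    have := hev a ha
    rw [hx0, map_zero] at this
    exact this.symm

/-- the tangent bundle parametrisation -/
noncomputable def QQ (p : Fin n → Polynomial K) (q : Polynomial K) (w : Fin n → Polynomial K)
    (a s : K) : Fin (n + n) → K :=
  Fin.append (PP p q a) (fun i => s * (w i).eval a)

lemma Good.mem_TC [CharZero K] (G : Good C p q V i0) (hs : ∀ x ∈ C, tangentDimAt C x = 1)
    (w : Fin n → Polynomial K)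
    (hw1 : ∀ a, ∃ i, (w i).eval a ≠ 0)
    (hw2 : ∀ a, q.eval a ≠ 0 → (fun i => (w i).eval a) ∈ tangentSpaceAt C (PP p q a))
    (z : Fin (n + n) → K) :
    z ∈ tangentBundle C ↔ ∃ a s, q.eval a ≠ 0 ∧ z = QQ p q w a s := by
  have hInf : Infinite K := IsAlgClosed.instInfinite
  constructor
  · rintro ⟨hz1, hz2⟩
    obtain ⟨a, ha, hza⟩ := G.surj _ hz1
    rw [hza] at hz2
    have hd := hs _ hz1
    rw [hza, tangentDimAt] at hd
    set T := Submodule.span K (tangentSpaceAt C (PP p q a))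
    have hwT : (fun i => (w i).eval a) ∈ T := Submodule.subset_span (hw2 a ha)
    have hzT : sndProj z ∈ T := Submodule.subset_span hz2
    have hne : (⟨_, hwT⟩ : T) ≠ 0 := by
      intro h0
      obtain ⟨i, hi⟩ := hw1 a
      apply hi
      have := congrArg Subtype.val h0
      exact congrFun this i
    obtain ⟨s, hsz⟩ := (finrank_eq_one_iff_of_nonzero' _ hne).1 hd ⟨_, hzT⟩
    refine ⟨a, s, ha, ?_⟩
    have h1 : (fun i => s * (w i).eval a) = sndProj z := congrArg Subtype.val hsz
    rw [QQ, h1, ← hza]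
    funext i
    refine Fin.addCases (fun i => ?_) (fun i => ?_) i
    · simp [fstProj]
    · exact (Fin.append_right (fstProj z) (sndProj z) i).symm
  · rintro ⟨a, s, ha, rfl⟩
    have h1 : fstProj (QQ p q w a s) = PP p q a := by funext i; simp [fstProj, QQ]
    have h2 : sndProj (QQ p q w a s) = fun i => s * (w i).eval a := by
      funext i; rw [sndProj, QQ, Fin.append_right]
    refine ⟨?_, ?_⟩
    · rw [h1]; exact G.mem a ha
    · rw [h1, h2]
      intro f hf
      have := hw2 a ha f hf
      calc _ = s * ∑ i, eval (PP p q a) (pderiv i f) * (w i).eval a := by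
            rw [Finset.mul_sum]; exact Finset.sum_congr rfl fun i _ => by ring
        _ = 0 := by rw [this, mul_zero]

/-- comorphism of tangent bundle parametrisation -/
noncomputable def ps (p : Fin n → Polynomial K) (q : Polynomial K) (w : Fin n → Polynomial K) :
    MvPolynomial (Fin (n + n)) K →ₐ[K] Polynomial (BB q) :=
  aeval (Fin.append (fun i => Polynomial.C (io q (p i) * iv q))
    (fun i => Polynomial.C (io q (w i)) * Polynomial.X))

lemma ev_ps (p : Fin n → Polynomial K) (q : Polynomial K) (w : Fin n → Polynomial K)
    (a s : K) (ha : q.eval a ≠ 0) (f : MvPolynomial (Fin (n + n)) K) :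
    Polynomial.eval₂ (ev q a ha) s (ps p q w f) = aeval (QQ p q w a s) f := by
  induction f using MvPolynomial.induction_on with
  | C c =>
    have : ps p q w (MvPolynomial.C c) = Polynomial.C (io q (Polynomial.C c)) := by
      rw [ps, aeval_C, Polynomial.algebraMap_apply]
      congr 1
    rw [this, Polynomial.eval₂_C, ev_io]; simp
  | add f g hf hg => rw [map_add, Polynomial.eval₂_add, hf, hg, map_add]
  | mul_X f i hf =>
    rw [map_mul, Polynomial.eval₂_mul, hf, map_mul]
    congr 1
    rw [ps, aeval_X, aeval_X, QQ]
    refine Fin.addCases (fun i => ?_) (fun i => ?_) i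
    · simp [PP, ev_io, ev_iv, div_eq_mul_inv]
    · rw [Fin.append_right, Fin.append_right, Polynomial.eval₂_mul, Polynomial.eval₂_C,
        Polynomial.eval₂_X, ev_io, mul_comm]

lemma Good.ker_ps [CharZero K] (G : Good C p q V i0) (hs : ∀ x ∈ C, tangentDimAt C x = 1)
    (w : Fin n → Polynomial K)
    (hw1 : ∀ a, ∃ i, (w i).eval a ≠ 0)
    (hw2 : ∀ a, q.eval a ≠ 0 → (fun i => (w i).eval a) ∈ tangentSpaceAt C (PP p q a)) :
    RingHom.ker (ps p q w : MvPolynomial (Fin (n + n)) K →+* Polynomial (BB q)) =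
      vanishingIdeal K (tangentBundle C) := by
  have hInf : Infinite K := IsAlgClosed.instInfinite
  ext f
  rw [RingHom.mem_ker]
  constructor
  · intro h z hz
    obtain ⟨a, s, ha, rfl⟩ := (G.mem_TC hs w hw1 hw2 z).1 hz
    rw [← ev_ps p q w a s ha, show ps p q w f = 0 from h, Polynomial.eval₂_zero]
  · intro h
    change ps p q w f = 0
    ext k
    rw [Polynomial.coeff_zero]
    refine eq_zero_of_ev q _ V G.infinite G.V_sub fun a ha => ?_
    have h0 : (ps p q w f).map (ev q a (G.V_sub a ha)) = 0 := by
      apply Polynomial.funext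
      intro s
      rw [Polynomial.eval_map, ev_ps, Polynomial.eval_zero]
      exact h _ ((G.mem_TC hs w hw1 hw2 _).2 ⟨a, s, G.V_sub a ha, rfl⟩)
    rw [← Polynomial.coeff_map, h0, Polynomial.coeff_zero]

lemma Good.isIntegral_ps (G : Good C p q V i0)
    (w : Fin n → Polynomial K)
    (hw1 : ∀ a, ∃ i, (w i).eval a ≠ 0) :
    (ps p q w : MvPolynomial (Fin (n + n)) K →+* Polynomial (BB q)).IsIntegral := by
  set Ψ := (ps p q w : MvPolynomial (Fin (n + n)) K →+* Polynomial (BB q)) with hΨ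
  have hcomp : Ψ.comp (rename (Fin.castAdd n) : MvPolynomial (Fin n) K →ₐ[K] _).toRingHom =
      (Polynomial.C : BB q →+* _).comp (ph p q : MvPolynomial (Fin n) K →+* BB q) := by
    apply MvPolynomial.ringHom_ext
    · intro c
      simp only [hΨ, RingHom.comp_apply, AlgHom.toRingHom_eq_coe, RingHom.coe_coe, rename_C]
      rw [ps, ph, aeval_C, aeval_C, Polynomial.algebraMap_apply]
    · intro i
      simp [hΨ, ps, ph]
  have hB : ∀ x : BB q, Ψ.IsIntegralElem (Polynomial.C x) := by
    intro x
    obtain ⟨F, hF, hx⟩ := G.isIntegral x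
    refine ⟨F.map (rename (Fin.castAdd n) : MvPolynomial (Fin n) K →ₐ[K] _).toRingHom,
      hF.map _, ?_⟩
    rw [Polynomial.eval₂_map, hcomp, ← Polynomial.hom_eval₂, hx, map_zero]
  have hX : Ψ.IsIntegralElem Polynomial.X := by
    have htop : Ideal.span (Set.range w) = ⊤ := by
      by_contra h
      obtain ⟨a, ha⟩ := exists_common_root w h
      obtain ⟨i, hi⟩ := hw1 a
      exact hi (ha i)
    obtain ⟨c, hc⟩ := (Ideal.mem_span_range_iff_exists_fun).1
      (htop ▸ Submodule.mem_top : (1 : Polynomial K) ∈ Ideal.span (Set.range w))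
    have e : (Polynomial.X : Polynomial (BB q)) =
        ∑ i, Polynomial.C (io q (c i)) * Ψ (X (Fin.natAdd n i)) := by
      have : ∀ i, Ψ (X (Fin.natAdd n i)) = Polynomial.C (io q (w i)) * Polynomial.X := by
        intro i
        change ps p q w (X (Fin.natAdd n i)) = _
        rw [ps, aeval_X, Fin.append_right]
      simp only [this, ← mul_assoc, ← Polynomial.C_mul, ← map_mul]
      rw [← Finset.sum_mul, ← map_sum, ← map_sum, hc]; simp
    rw [e]
    refine Finset.sum_induction _ (fun x => Ψ.IsIntegralElem x) (fun _ _ h1 h2 => h1.add _ h2)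
      (RingHom.isIntegralElem_zero _) fun i _ => (hB _).mul _ (RingHom.isIntegralElem_map _)
  intro x
  induction x using Polynomial.induction_on' with
  | add f g hf hg => exact hf.add _ hg
  | monomial k c =>
    rw [← Polynomial.C_mul_X_pow_eq_monomial]
    exact (hB c).mul _ (integralElem_pow hX k)

lemma Good.varDim_TC [CharZero K] (G : Good C p q V i0) (hd : varDim C = 1)
    (hs : ∀ x ∈ C, tangentDimAt C x = 1)
    (w : Fin n → Polynomial K)
    (hw1 : ∀ a, ∃ i, (w i).eval a ≠ 0)
    (hw2 : ∀ a, q.eval a ≠ 0 → (fun i => (w i).eval a) ∈ tangentSpaceAt C (PP p q a)) :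
    varDim (tangentBundle C) = 2 := by
  have hInf : Infinite K := IsAlgClosed.instInfinite
  have h1 := ringKrullDim_quot_ker_eq _ G.isIntegral
  have h2 := ringKrullDim_quot_ker_eq _ (G.isIntegral_ps w hw1)
  have hN : IsNoetherianRing (BB q) := IsLocalization.isNoetherianRing (Submonoid.powers q) _
    inferInstance
  rw [G.ker_ps hs w hw1 hw2, Polynomial.ringKrullDim_of_isNoetherianRing, ← h1, G.ker] at h2
  rw [varDim] at hd ⊢
  rw [h2]
  generalize ringKrullDim (MvPolynomial (Fin n) K ⧸ vanishingIdeal K C) = r at hd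
  induction r using WithBot.recBotCoe with
  | bot => simp at hd
  | coe r =>
    induction r using ENat.recTopCoe with
    | top => change ENat.toNat ⊤ = 1 at hd; simp at hd
    | coe r =>
      simp at hd
      subst hd
      rfl

end tangent
end RatTB


open MvPolynomial

namespace RatTB

section counting
variable {K : Type} [Field K] [IsAlgClosed K] {n : ℕ}
variable {C : Set (Fin n → K)} {p : Fin n → Polynomial K} {q : Polynomial K} {V : Set K}
  {i0 : Fin n}

lemma exists_ker {N r : ℕ} (D : Submodule K (Fin N → K)) (hr : r ≤ N)
    (h : Module.finrank K D = N - r) :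
    ∃ l : (Fin N → K) →ₗ[K] (Fin r → K), LinearMap.ker l = D := by
  have h1 := Submodule.finrank_quotient_add_finrank D
  have h2 : Module.finrank K ((Fin N → K) ⧸ D) = Module.finrank K (Fin r → K) := by
    simp only [Module.finrank_fin_fun] at h1 ⊢
    omega
  refine ⟨(LinearEquiv.ofFinrankEq _ _ h2).toLinearMap.comp D.mkQ, ?_⟩
  rw [LinearEquiv.ker_comp, Submodule.ker_mkQ]

lemma exists_eqns {N r : ℕ} (L : AffineSubspace K (Fin N → K)) (hr : r ≤ N)
    (h : Module.finrank K L.direction = N - r) (z0 : Fin N → K) (hz0 : z0 ∈ L) :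
    ∃ (l : Fin r → Fin N → K) (c : Fin r → K), ∀ z, z ∈ L ↔ ∀ k, ∑ i, l k i * z i = c k := by
  obtain ⟨l, hl⟩ := exists_ker L.direction hr h
  have hsum : ∀ z k, l z k = ∑ i, l (Pi.single i 1) k * z i := by
    intro z k
    conv_lhs => rw [LinearMap.pi_apply_eq_sum_univ l z]
    rw [Finset.sum_apply]
    refine Finset.sum_congr rfl fun i _ => ?_
    rw [Pi.smul_apply, smul_eq_mul, mul_comm]
    have e : (fun j => if i = j then (1 : K) else 0) = Pi.single i 1 := by
      funext j
      simp [Pi.single_apply, eq_comm]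
    rw [e]
  refine ⟨fun k i => l (Pi.single i 1) k, l z0, fun z => ?_⟩
  rw [← AffineSubspace.vsub_right_mem_direction_iff_mem hz0 z, ← hl, LinearMap.mem_ker,
    vsub_eq_sub, map_sub, sub_eq_zero, _root_.funext_iff]
  simp only [hsum z]

lemma QQ_inj_right (p : Fin n → Polynomial K) (q : Polynomial K) (w : Fin n → Polynomial K)
    (hw1 : ∀ a, ∃ i, (w i).eval a ≠ 0) (a : K) : Function.Injective (QQ p q w a) := by
  intro s t h
  obtain ⟨i, hi⟩ := hw1 a
  have := congrFun h (Fin.natAdd n i)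
  rw [QQ, QQ, Fin.append_right, Fin.append_right] at this
  exact mul_right_cancel₀ hi this

lemma QQ_fst (p : Fin n → Polynomial K) (q : Polynomial K) (w : Fin n → Polynomial K)
    {a b s t : K} (h : QQ p q w a s = QQ p q w b t) : PP p q a = PP p q b := by
  funext i
  have := congrFun h (Fin.castAdd n i)
  rwa [QQ, QQ, Fin.append_left, Fin.append_left] at this

lemma natDegree_sub_le_same {f g : Polynomial K} {m : ℕ} (hf : f.natDegree ≤ m)
    (hg : g.natDegree ≤ m) : (f - g).natDegree ≤ m :=
  (Polynomial.natDegree_sub_le_of_le hf hg).trans (max_self m).le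

lemma Good.count (G : Good C p q V i0) (w : Fin n → Polynomial K)
    (hw1 : ∀ a, ∃ i, (w i).eval a ≠ 0) (A B : Fin 2 → Polynomial K) (d : ℕ) (hd : 1 ≤ d)
    (hA : ∀ k, (A k).natDegree ≤ d) (hB : ∀ k, (B k).natDegree ≤ 2 * d - 2)
    (S : Set (Fin (n + n) → K))
    (hS : ∀ z, z ∈ S ↔ ∃ a s, q.eval a ≠ 0 ∧ z = QQ p q w a s ∧
      ∀ k, (A k).eval a + s * q.eval a * (B k).eval a = 0)
    (hfin : S.Finite) : S.ncard ≤ 3 * d - 2 := by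
  classical
  have hInf : Infinite K := IsAlgClosed.instInfinite
  have hvert : ∀ a, q.eval a ≠ 0 → (∀ k, (A k).eval a = 0 ∧ (B k).eval a = 0) → False := by
    intro a ha h
    refine Set.infinite_of_injective_forall_mem (QQ_inj_right p q w hw1 a) (s := S)
      (fun t => (hS _).2 ⟨a, t, ha, rfl, fun k => ?_⟩) hfin
    rw [(h k).1, (h k).2]; ring
  by_cases hΔ : A 0 * B 1 - A 1 * B 0 = 0
  · rcases S.eq_empty_or_nonempty with h0 | ⟨z, hz⟩
    · simp [h0]
    exfalso
    have hAB : ∀ j k, A j * B k = A k * B j := by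
      have := sub_eq_zero.1 hΔ
      intro j k
      fin_cases j <;> fin_cases k
      · rfl
      · exact this
      · exact this.symm
      · rfl
    by_cases hk : ∃ k, B k ≠ 0
    · obtain ⟨k, hk⟩ := hk
      have hinf : (V \ {b | (B k).eval b = 0}).Infinite := G.infinite.sdiff
        (Polynomial.finite_setOfPred_isRoot hk)
      refine Set.infinite_of_injOn_mapsTo (s := V \ {b | (B k).eval b = 0}) (t := S)
        (f := fun a => QQ p q w a (-(A k).eval a / (q.eval a * (B k).eval a))) ?_ ?_ hinf hfin
      · intro a ha b hb hab
        exact G.inj ha.1 hb.1 (QQ_fst p q w hab)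
      · intro a ha
        have hq := G.V_sub a ha.1
        have hb : (B k).eval a ≠ 0 := ha.2
        refine (hS _).2 ⟨a, _, hq, rfl, fun j => ?_⟩
        have := congrArg (Polynomial.eval a) (hAB j k)
        rw [Polynomial.eval_mul, Polynomial.eval_mul] at this
        field_simp
        linear_combination this
    · push Not at hk
      obtain ⟨a, s, ha, -, h⟩ := (hS z).1 hz
      refine hvert a ha fun k => ?_
      have := h k
      rw [hk k] at this ⊢
      simpa using this
  · have hex : ∀ z ∈ S, ∃ a s, q.eval a ≠ 0 ∧ z = QQ p q w a s ∧
      ∀ k, (A k).eval a + s * q.eval a * (B k).eval a = 0 := fun z hz => (hS z).1 hz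
    choose! f g hf using hex
    have huniq : ∀ a s t, q.eval a ≠ 0 → (∀ k, (A k).eval a + s * q.eval a * (B k).eval a = 0) →
        (∀ k, (A k).eval a + t * q.eval a * (B k).eval a = 0) → s = t := by
      intro a s t ha h1 h2
      by_contra hst
      refine hvert a ha fun k => ?_
      have h3 : (s - t) * q.eval a * (B k).eval a = 0 := by linear_combination h1 k - h2 k
      have h4 : (B k).eval a = 0 :=
        (mul_eq_zero.1 h3).resolve_left (mul_ne_zero (sub_ne_zero.2 hst) ha)
      refine ⟨?_, h4⟩
      have := h1 k
      rw [h4] at this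
      simpa using this
    have h1 : S.ncard ≤ ((A 0 * B 1 - A 1 * B 0).roots.toFinset : Set K).ncard := by
      refine Set.ncard_le_ncard_of_injOn f ?_ ?_ (Finset.finite_toSet _)
      · intro z hz
        obtain ⟨-, -, h⟩ := hf z hz
        rw [Finset.mem_coe, Multiset.mem_toFinset, Polynomial.mem_roots hΔ, Polynomial.IsRoot.def]
        simp only [Polynomial.eval_sub, Polynomial.eval_mul]
        linear_combination (B 1).eval (f z) * h 0 - (B 0).eval (f z) * h 1
      · intro z hz z' hz' hzz
        obtain ⟨h1, h2, h3⟩ := hf z hz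
        obtain ⟨h1', h2', h3'⟩ := hf z' hz'
        rw [h2, h2', ← hzz]
        rw [← hzz] at h3'
        rw [huniq _ _ _ h1 h3 h3']
    rw [Set.ncard_coe_finset] at h1
    have h2 := Multiset.toFinset_card_le (A 0 * B 1 - A 1 * B 0).roots
    have h3 := Polynomial.card_roots' (A 0 * B 1 - A 1 * B 0)
    have h4 : (A 0 * B 1 - A 1 * B 0).natDegree ≤ d + (2 * d - 2) :=
      natDegree_sub_le_same
        (Polynomial.natDegree_mul_le_of_le (hA 0) (hB 1))
        (Polynomial.natDegree_mul_le_of_le (hA 1) (hB 0))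
    omega

lemma natDegree_comb (u : Fin n → K) (v : Fin n → Polynomial K) (m : ℕ)
    (hv : ∀ i, (v i).natDegree ≤ m) :
    (∑ i, Polynomial.C (u i) * v i).natDegree ≤ m :=
  Polynomial.natDegree_sum_le_of_forall_le _ _ fun i _ =>
    (Polynomial.natDegree_C_mul_le _ _).trans (hv i)

lemma eval_comb (u : Fin n → K) (v : Fin n → Polynomial K) (a : K) :
    (∑ i, Polynomial.C (u i) * v i).eval a = ∑ i, u i * (v i).eval a := by
  simp [Polynomial.eval_finsetSum]

lemma comb_PP (u : Fin n → K) (p : Fin n → Polynomial K) (q : Polynomial K) (a : K)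
    (ha : q.eval a ≠ 0) :
    (∑ i, u i * PP p q a i) * q.eval a = ∑ i, u i * (p i).eval a := by
  rw [Finset.sum_mul]
  refine Finset.sum_congr rfl fun i _ => ?_
  rw [PP, mul_assoc, div_mul_cancel₀ _ ha]

lemma Good.TC_bound [CharZero K] (G : Good C p q V i0) (hs : ∀ x ∈ C, tangentDimAt C x = 1)
    (w : Fin n → Polynomial K) (hw0 : ∀ i, (w i).natDegree ≤ 2 * (p i0).natDegree - 2)
    (hw1 : ∀ a, ∃ i, (w i).eval a ≠ 0)
    (hw2 : ∀ a, q.eval a ≠ 0 → (fun i => (w i).eval a) ∈ tangentSpaceAt C (PP p q a))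
    (L : AffineSubspace K (Fin (n + n) → K)) (hL : Module.finrank K L.direction = n + n - 2)
    (hfin : (tangentBundle C ∩ (L : Set (Fin (n + n) → K))).Finite) :
    (tangentBundle C ∩ (L : Set (Fin (n + n) → K))).ncard ≤ 3 * (p i0).natDegree - 2 := by
  rcases (tangentBundle C ∩ (L : Set (Fin (n + n) → K))).eq_empty_or_nonempty with h0 | ⟨z0, hz0⟩
  · simp [h0]
  have hn : 0 < n := i0.pos
  have hdl := G.deg_lt
  obtain ⟨l, c, hl⟩ := exists_eqns (r := 2) L (by omega) hL z0 hz0.2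
  refine G.count w hw1
    (fun k => (∑ i, Polynomial.C (l k (Fin.castAdd n i)) * p i) - Polynomial.C (c k) * q)
    (fun k => ∑ i, Polynomial.C (l k (Fin.natAdd n i)) * w i) (p i0).natDegree (by omega)
    ?_ ?_ _ ?_ hfin
  · intro k
    exact natDegree_sub_le_same (natDegree_comb _ _ _ G.deg_le)
      ((Polynomial.natDegree_C_mul_le _ _).trans hdl.le)
  · intro k
    exact natDegree_comb _ _ _ hw0
  · intro z
    have key : ∀ a s, q.eval a ≠ 0 → (QQ p q w a s ∈ L ↔ ∀ k,
      ((∑ i, Polynomial.C (l k (Fin.castAdd n i)) * p i) - Polynomial.C (c k) * q).eval a +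
        s * q.eval a * (∑ i, Polynomial.C (l k (Fin.natAdd n i)) * w i).eval a = 0) := by
      intro a s ha
      rw [hl]
      refine forall_congr' fun k => ?_
      rw [Fin.sum_univ_add, Polynomial.eval_sub, eval_comb, eval_comb, Polynomial.eval_mul,
        Polynomial.eval_C, ← comb_PP _ p q a ha]
      simp only [QQ, Fin.append_left, Fin.append_right]
      have e : ∑ i, l k (Fin.natAdd n i) * (s * (w i).eval a) =
          s * ∑ i, l k (Fin.natAdd n i) * (w i).eval a := by
        rw [Finset.mul_sum]; exact Finset.sum_congr rfl fun i _ => by ring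
      rw [e]
      constructor
      · intro h; rw [← h]; ring
      · intro h; apply mul_right_cancel₀ ha; linear_combination h
    constructor
    · rintro ⟨h1, h2⟩
      obtain ⟨a, s, ha, rfl⟩ := (G.mem_TC hs w hw1 hw2 z).1 h1
      exact ⟨a, s, ha, rfl, (key a s ha).1 h2⟩
    · rintro ⟨a, s, ha, rfl, h⟩
      exact ⟨(G.mem_TC hs w hw1 hw2 _).2 ⟨a, s, ha, rfl⟩, (key a s ha).2 h⟩

lemma Good.C_sub (G : Good C p q V i0) (u : Fin n → K) (c : K) (x : Fin n → K) (hx : x ∈ C)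
    (hc : ∑ i, u i * x i = c) : ∃ a, q.eval a ≠ 0 ∧ x = PP p q a ∧
      ((∑ i, Polynomial.C (u i) * p i) - Polynomial.C c * q).eval a = 0 := by
  obtain ⟨a, ha, rfl⟩ := G.surj x hx
  refine ⟨a, ha, rfl, ?_⟩
  rw [Polynomial.eval_sub, eval_comb, Polynomial.eval_mul, Polynomial.eval_C,
    ← comb_PP _ p q a ha, hc, sub_self]

lemma Good.C_bound (G : Good C p q V i0)
    (L : AffineSubspace K (Fin n → K)) (hL : Module.finrank K L.direction = n - 1)
    (hfin : (C ∩ (L : Set (Fin n → K))).Finite) :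
    (C ∩ (L : Set (Fin n → K))).ncard ≤ (p i0).natDegree := by
  classical
  have hInf : Infinite K := IsAlgClosed.instInfinite
  rcases (C ∩ (L : Set (Fin n → K))).eq_empty_or_nonempty with h0 | ⟨z0, hz0⟩
  · simp [h0]
  have hn : 0 < n := i0.pos
  have hdl := G.deg_lt
  obtain ⟨l, c, hl⟩ := exists_eqns (r := 1) L (by omega) hL z0 hz0.2
  set f := (∑ i, Polynomial.C (l 0 i) * p i) - Polynomial.C (c 0) * q with hf
  have hdeg : f.natDegree ≤ (p i0).natDegree :=
    natDegree_sub_le_same (natDegree_comb _ _ _ G.deg_le)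
      ((Polynomial.natDegree_C_mul_le _ _).trans hdl.le)
  have hf0 : f ≠ 0 := by
    intro h0
    refine Set.infinite_of_injOn_mapsTo (s := V) (t := C ∩ (L : Set (Fin n → K)))
      (f := PP p q) G.inj ?_ G.infinite hfin
    intro a ha
    have hq := G.V_sub a ha
    refine ⟨G.mem a hq, (hl _).2 fun k => ?_⟩
    rw [Subsingleton.elim k 0]
    have := congrArg (Polynomial.eval a) h0
    rw [hf, Polynomial.eval_sub, eval_comb, Polynomial.eval_mul, Polynomial.eval_C,
      ← comb_PP _ p q a hq, Polynomial.eval_zero] at this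
    apply mul_right_cancel₀ hq
    linear_combination this
  have hsub : C ∩ (L : Set (Fin n → K)) ⊆ PP p q '' (f.roots.toFinset : Set K) := by
    rintro x ⟨hx, hxL⟩
    obtain ⟨a, ha, rfl, h⟩ := G.C_sub (l 0) (c 0) x hx ((hl x).1 hxL 0)
    refine ⟨a, ?_, rfl⟩
    rw [Finset.mem_coe, Multiset.mem_toFinset, Polynomial.mem_roots hf0]
    exact h
  have h1 := Set.ncard_le_ncard hsub ((Finset.finite_toSet _).image _)
  have h2 := Set.ncard_image_le (f := PP p q) (Finset.finite_toSet f.roots.toFinset)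
  rw [Set.ncard_coe_finset] at h2
  have h3 := Multiset.toFinset_card_le f.roots
  have h4 := Polynomial.card_roots' f
  omega

lemma finite_bad (u : Fin n → K) (i : Fin n) (hu : u i ≠ 0) :
    {t : K | ∑ j : Fin n, t ^ (j : ℕ) * u j = 0}.Finite := by
  set F : Polynomial K := ∑ j : Fin n, Polynomial.C (u j) * Polynomial.X ^ (j : ℕ) with hF
  have hF0 : F ≠ 0 := by
    intro h
    have := congrArg (fun P => Polynomial.coeff P (i : ℕ)) h
    simp only [hF, Polynomial.finsetSum_coeff, Polynomial.coeff_C_mul, Polynomial.coeff_X_pow,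
      Polynomial.coeff_zero] at this
    rw [Finset.sum_eq_single i] at this
    · simp at this; exact hu this
    · intro j _ hj
      rw [if_neg (fun h => hj (Fin.ext h.symm)), mul_zero]
    · simp
  refine (Polynomial.finite_setOfPred_isRoot hF0).subset ?_
  intro t ht
  change F.eval t = 0
  rw [← show _ = (0 : K) from ht, hF, Polynomial.eval_finsetSum]
  refine Finset.sum_congr rfl fun j _ => ?_
  rw [Polynomial.eval_mul, Polynomial.eval_C, Polynomial.eval_pow, Polynomial.eval_X, mul_comm]

lemma Good.exists_L [CharZero K] (G : Good C p q V i0) :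
    ∃ L : AffineSubspace K (Fin n → K), Module.finrank K L.direction = n - 1 ∧
      (C ∩ (L : Set (Fin n → K))).Finite ∧
      (p i0).natDegree ≤ (C ∩ (L : Set (Fin n → K))).ncard := by
  classical
  have hInf : Infinite K := IsAlgClosed.instInfinite
  have hn : 0 < n := i0.pos
  set d := (p i0).natDegree with hd
  have hdl := G.deg_lt
  have hfinq : {b : K | q.eval b = 0}.Finite := Polynomial.finite_setOfPred_isRoot G.q_ne
  obtain ⟨t, ht⟩ : ∃ t : K, t ∉ {t : K | ∑ j : Fin n, t ^ (j : ℕ) * (p j).coeff d = 0} ∪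
      ⋃ b ∈ {b : K | q.eval b = 0}, {t : K | ∑ j : Fin n, t ^ (j : ℕ) * (p j).eval b = 0} := by
    apply Set.Finite.exists_notMem
    refine (finite_bad _ i0 ?_).union (hfinq.biUnion fun b hb => ?_)
    · rw [hd, Polynomial.coeff_natDegree]
      intro h
      rw [Polynomial.leadingCoeff_eq_zero] at h
      rw [h] at hdl; simp at hdl
    · obtain ⟨i, hi⟩ := G.nocommon b hb
      exact finite_bad _ i hi
  rw [Set.mem_union, not_or] at ht
  obtain ⟨ht1, ht2⟩ := ht
  set A : Polynomial K := ∑ j : Fin n, Polynomial.C (t ^ (j : ℕ)) * p j with hA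
  have hAd : A.coeff d ≠ 0 := by
    rw [hA, Polynomial.finsetSum_coeff]
    simp only [Polynomial.coeff_C_mul]
    exact ht1
  have hAle : A.natDegree ≤ d := natDegree_comb _ _ _ G.deg_le
  have hAdeg : A.natDegree = d := le_antisymm hAle (Polynomial.le_natDegree_of_ne_zero hAd)
  have hAq : ∀ b, q.eval b = 0 → A.eval b ≠ 0 := by
    intro b hb h0
    apply ht2
    rw [hA, eval_comb] at h0
    exact Set.mem_biUnion (x := b) hb h0
  have hW := wr_ne_zero A q G.q_ne (hAdeg ▸ hdl)
  set W := Polynomial.derivative A * q - A * Polynomial.derivative q with hWdef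
  obtain ⟨c, hc⟩ : ∃ c : K, c ∉ (fun a => A.eval a / q.eval a) '' (Vᶜ ∪ {a | W.eval a = 0}) :=
    Set.Finite.exists_notMem
      ((G.cofin.union (Polynomial.finite_setOfPred_isRoot hW)).image _)
  set f := A - Polynomial.C c * q with hf
  have hfc : f.coeff d ≠ 0 := by
    rw [hf, Polynomial.coeff_sub, Polynomial.coeff_C_mul,
      Polynomial.coeff_eq_zero_of_natDegree_lt hdl, mul_zero, sub_zero]
    exact hAd
  have hf0 : f ≠ 0 := by rintro h; rw [h] at hfc; simp at hfc
  have hfd : d ≤ f.natDegree := Polynomial.le_natDegree_of_ne_zero hfc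
  have hroot : ∀ a, f.eval a = 0 → a ∈ V ∧ (Polynomial.derivative f).eval a ≠ 0 := by
    intro a ha
    rw [hf, Polynomial.eval_sub, Polynomial.eval_mul, Polynomial.eval_C] at ha
    have hq : q.eval a ≠ 0 := by
      intro h0
      rw [h0, mul_zero, sub_zero] at ha
      exact hAq a h0 ha
    have hca : A.eval a / q.eval a = c := by
      rw [div_eq_iff hq]; linear_combination ha
    have hnot : a ∉ Vᶜ ∪ {a | W.eval a = 0} := fun h => hc ⟨a, h, hca⟩
    rw [Set.mem_union, not_or, Set.notMem_compl_iff] at hnot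
    refine ⟨hnot.1, fun h0 => hnot.2 ?_⟩
    rw [hf, Polynomial.derivative_sub, Polynomial.derivative_C_mul, Polynomial.eval_sub,
      Polynomial.eval_mul, Polynomial.eval_C] at h0
    change W.eval a = 0
    rw [hWdef, Polynomial.eval_sub, Polynomial.eval_mul, Polynomial.eval_mul]
    linear_combination q.eval a * h0 - (Polynomial.derivative q).eval a * ha
  have hnodup : f.roots.Nodup := by
    rw [Multiset.nodup_iff_count_le_one]
    intro a
    rw [Polynomial.count_roots]
    by_contra h
    have := (Polynomial.one_lt_rootMultiplicity_iff_isRoot hf0).1 (not_le.1 h)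
    exact (hroot a this.1).2 this.2
  have hcard : d ≤ f.roots.toFinset.card := by
    rw [Multiset.toFinset_card_of_nodup hnodup, IsAlgClosed.card_roots_eq_natDegree]
    exact hfd
  let φ : (Fin n → K) →ₗ[K] K := ∑ j : Fin n, (t ^ (j : ℕ)) • LinearMap.proj j
  have hφ : ∀ x, φ x = ∑ j : Fin n, t ^ (j : ℕ) * x j := by
    intro x; simp [φ]
  have hφs : ∀ e : K, φ (Pi.single ⟨0, hn⟩ e) = e := by
    intro e
    rw [hφ, Finset.sum_eq_single ⟨0, hn⟩]
    · simp
    · intro j _ hj; rw [Pi.single_eq_of_ne hj, mul_zero]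
    · simp
  let x0 : Fin n → K := Pi.single (⟨0, hn⟩ : Fin n) c
  have hx0 : φ x0 = c := hφs c
  let L : AffineSubspace K (Fin n → K) := AffineSubspace.mk' x0 (LinearMap.ker φ)
  have hmem : ∀ x, x ∈ L ↔
      ∑ j : Fin n, t ^ (j : ℕ) * x j = c := by
    intro x
    rw [AffineSubspace.mem_mk', LinearMap.mem_ker, vsub_eq_sub, map_sub, hx0, hφ, sub_eq_zero]
  refine ⟨L, ?_, ?_⟩
  · rw [AffineSubspace.direction_mk']
    have h1 := LinearMap.finrank_range_add_finrank_ker φ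
    rw [LinearMap.range_eq_top.2 (fun e => ⟨_, hφs e⟩), finrank_top, Module.finrank_self,
      Module.finrank_fin_fun] at h1
    omega
  · have hfin : (C ∩ (L : Set (Fin n → K))).Finite := by
      refine ((Finset.finite_toSet f.roots.toFinset).image (PP p q)).subset ?_
      rintro x ⟨hx, hxL⟩
      obtain ⟨a, ha, rfl, h⟩ := G.C_sub (fun j => t ^ (j : ℕ)) c x hx ((hmem x).1 hxL)
      refine ⟨a, ?_, rfl⟩
      rw [Finset.mem_coe, Multiset.mem_toFinset, Polynomial.mem_roots hf0]
      exact h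
    refine ⟨hfin, ?_⟩
    rw [← Set.ncard_coe_finset] at hcard
    refine hcard.trans (Set.ncard_le_ncard_of_injOn (PP p q) ?_ ?_ hfin)
    · intro a ha
      rw [Finset.mem_coe, Multiset.mem_toFinset, Polynomial.mem_roots hf0] at ha
      have hq := G.V_sub a (hroot a ha).1
      refine ⟨G.mem a hq, (hmem _).2 ?_⟩
      apply mul_right_cancel₀ hq
      rw [comb_PP (fun j : Fin n => t ^ (j : ℕ)) p q a hq, ← eval_comb]
      have h0 : f.eval a = 0 := ha
      rw [hf, Polynomial.eval_sub, Polynomial.eval_mul, Polynomial.eval_C] at h0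
      exact sub_eq_zero.1 h0
    · intro a ha b hb hab
      rw [Finset.mem_coe, Multiset.mem_toFinset, Polynomial.mem_roots hf0] at ha hb
      exact G.inj (hroot a ha).1 (hroot b hb).1 hab

end counting
end RatTB


/-- For a smooth algebraic curve `C ⊆ A^n` with a rational parametric representation
satisfying (P1) and (P2), `deg(TC) ≤ 3·deg(C) − 2`. -/
theorem degree_tangentBundle_rat_param {K : Type} [Field K] [IsAlgClosed K] [CharZero K]
    {n : ℕ} (C : Set (Fin n → K)) (hC : IsSmoothCurve C)
    (g h : Fin n → Polynomial K) (hh : ∀ i, h i ≠ 0)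
    (hdom : C = zclosure ((fun t => fun i => (g i).eval t / (h i).eval t) ''
      {t | ∀ i, (h i).eval t ≠ 0}))
    (U : Set K) (hUopen : Uᶜ.Finite) (hUne : U.Nonempty)
    (hUD : U ⊆ {t | ∀ i, (h i).eval t ≠ 0})
    (hP1 : Set.InjOn (fun t => fun i => (g i).eval t / (h i).eval t) U)
    (hP2 : ∀ t ∈ U, ∃ i,
      (g i).derivative.eval t * (h i).eval t - (g i).eval t * (h i).derivative.eval t ≠ 0) :
    geomDegree (tangentBundle C) ≤ 3 * geomDegree C - 2 := by
  have hInf : Infinite K := IsAlgClosed.instInfinite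
  obtain ⟨p, q, V, i0, G⟩ := RatTB.exists_good C g h hh hdom U hUopen hUD hP1
  have hs : ∀ x ∈ C, tangentDimAt C x = 1 := fun x hx =>
    (hC.2.2 x hx : tangentDimAt C x = varDim C).trans hC.2.1
  obtain ⟨w, hw0, hw1, hw2⟩ := G.exists_w
  have hdim := G.varDim_TC hC.2.1 hs w hw1 hw2
  have h1 : geomDegree (tangentBundle C) ≤ 3 * (p i0).natDegree - 2 := by
    rw [geomDegree]
    refine csSup_le' ?_
    rintro m ⟨L, hL, hfin, rfl⟩
    rw [hdim] at hL
    exact G.TC_bound hs w hw0 hw1 hw2 L hL hfin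
  have h2 : (p i0).natDegree ≤ geomDegree C := by
    obtain ⟨L, hL, hfin, hle⟩ := G.exists_L
    refine hle.trans ?_
    rw [geomDegree]
    refine le_csSup ⟨(p i0).natDegree, ?_⟩ ⟨L, by rw [hC.2.1]; exact hL, hfin, rfl⟩
    rintro m ⟨L', hL', hfin', rfl⟩
    rw [hC.2.1] at hL'
    exact G.C_bound L' hL' hfin'
  omega
end
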